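/- For every couple Q there exists a unique prime couple Q_sk (called the skeleton of Q) such that Q can be obtained from Q_sk by finitely many applications of steps A and B; moreover Q is regular if and only if its skeleton is the trivial couple. -/

import Mathlib

namespace WKE

/-! Combinatorial framework: ternary trees, couples, steps A and B, regular couples.
Following Deng–Hani, "Full derivation of the wave kinetic equation". -/

/-- A ternary tree: every non-leaf (branching) node has exactly three ordered children. -/
inductive TTree : Type where
  | leaf : TTree
  | node : TTree → TTree → TTree → TTree
  deriving DecidableEq

/-- The scale of a tree: its number of branching nodes. -/
def TTree.scale : TTree → ℕ
  | .leaf => 0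
  | .node a b c => a.scale + b.scale + c.scale + 1

/-- A position (address) of a node in a ternary tree. -/
abbrev Pos : Type := List (Fin 3)

/-- A node of a couple: a side (`true` = the `+` tree) together with a position. -/
abbrev NodeId : Type := Bool × Pos

/-- The subtree at a given position, if the position is valid. -/
def TTree.subtreeAt? : TTree → Pos → Option TTree
  | t, [] => some t
  | .leaf, _ :: _ => none
  | .node a _ _, ⟨0, _⟩ :: p => a.subtreeAt? p
  | .node _ b _, ⟨1, _⟩ :: p => b.subtreeAt? p
  | .node _ _ c, ⟨_ + 2, _⟩ :: p => c.subtreeAt? p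

/-- `p` is the position of a leaf of `t`. -/
def TTree.IsLeafPos (t : TTree) (p : Pos) : Prop := t.subtreeAt? p = some .leaf

/-- `p` is the position of a branching node of `t`. -/
def TTree.IsBranchPos (t : TTree) (p : Pos) : Prop :=
  ∃ a b c, t.subtreeAt? p = some (.node a b c)

instance (t : TTree) (p : Pos) : Decidable (t.IsLeafPos p) := by
  unfold TTree.IsLeafPos; infer_instance

/-- The sign of the node at position `p` in a tree whose root has sign `b`
(`true` = `+`): the sign flips exactly when passing to a middle child. -/
def posSign (b : Bool) (p : Pos) : Bool := Bool.xor b (p.count (1 : Fin 3) % 2 == 1)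

/-- A couple: a pair of ternary trees of signs `+` and `-`, together with a partition of the
set of all leaves into pairs of leaves of opposite signs.  The pairing is encoded as a
fixed-point-free involution of the set of leaves, extended by the identity off the leaves. -/
structure Couple where
  pos : TTree
  neg : TTree
  pair : NodeId → NodeId
  pair_leaf : ∀ x : NodeId, (cond x.1 pos neg).IsLeafPos x.2 →
    (cond (pair x).1 pos neg).IsLeafPos (pair x).2
  pair_invol : ∀ x : NodeId, (cond x.1 pos neg).IsLeafPos x.2 → pair (pair x) = x
  pair_ne : ∀ x : NodeId, (cond x.1 pos neg).IsLeafPos x.2 → pair x ≠ x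
  pair_sign : ∀ x : NodeId, (cond x.1 pos neg).IsLeafPos x.2 →
    posSign (pair x).1 (pair x).2 = !(posSign x.1 x.2)
  pair_norm : ∀ x : NodeId, ¬ (cond x.1 pos neg).IsLeafPos x.2 → pair x = x

/-- The tree of a couple on a given side. -/
def Couple.treeOf (Q : Couple) (b : Bool) : TTree := cond b Q.pos Q.neg

/-- `x` is a leaf of the couple `Q`. -/
def Couple.IsLeaf (Q : Couple) (x : NodeId) : Prop := (Q.treeOf x.1).IsLeafPos x.2

/-- `x` is a branching node of the couple `Q`. -/
def Couple.IsBranch (Q : Couple) (x : NodeId) : Prop := (Q.treeOf x.1).IsBranchPos x.2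

/-- `x` is a node of the couple `Q`. -/
def Couple.IsNode (Q : Couple) (x : NodeId) : Prop := ((Q.treeOf x.1).subtreeAt? x.2).isSome

/-- The scale of a couple: the sum of the scales of its two trees. -/
def Couple.scale (Q : Couple) : ℕ := Q.pos.scale + Q.neg.scale

theorem isLeafPos_leaf_iff (p : Pos) : TTree.IsLeafPos .leaf p ↔ p = [] := by
  cases p with
  | nil => simp [TTree.IsLeafPos, TTree.subtreeAt?]
  | cons i q => simp [TTree.IsLeafPos, TTree.subtreeAt?]

/-- The pairing of the trivial couple: the two roots are paired. -/
def trivPair : NodeId → NodeId := fun x =>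
  if x = ((true, []) : NodeId) then ((false, []) : NodeId)
  else if x = ((false, []) : NodeId) then ((true, []) : NodeId) else x

/-- The trivial couple: two single-node trees with their roots paired. -/
def trivialCouple : Couple where
  pos := .leaf
  neg := .leaf
  pair := trivPair
  pair_leaf := by
    rintro ⟨b, p⟩ hp
    have hp' : p = [] := by cases b <;> exact (isLeafPos_leaf_iff p).mp hp
    subst hp'
    cases b <;> decide
  pair_invol := by
    rintro ⟨b, p⟩ hp
    have hp' : p = [] := by cases b <;> exact (isLeafPos_leaf_iff p).mp hp
    subst hp'
    cases b <;> decide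
  pair_ne := by
    rintro ⟨b, p⟩ hp
    have hp' : p = [] := by cases b <;> exact (isLeafPos_leaf_iff p).mp hp
    subst hp'
    cases b <;> decide
  pair_sign := by
    rintro ⟨b, p⟩ hp
    have hp' : p = [] := by cases b <;> exact (isLeafPos_leaf_iff p).mp hp
    subst hp'
    cases b <;> decide
  pair_norm := by
    rintro ⟨b, p⟩ hp
    rcases p with _ | ⟨i, q⟩
    · exfalso
      apply hp
      cases b <;> exact (isLeafPos_leaf_iff []).mpr rfl
    · simp [trivPair]

/-- Replace the subtree at position `p` of `t` by `s`. -/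
def TTree.replaceAt : TTree → Pos → TTree → TTree
  | _, [], s => s
  | .leaf, _ :: _, _ => .leaf
  | .node a b c, ⟨0, _⟩ :: p, s => .node (a.replaceAt p s) b c
  | .node a b c, ⟨1, _⟩ :: p, s => .node a (b.replaceAt p s) c
  | .node a b c, ⟨_ + 2, _⟩ :: p, s => .node a b (c.replaceAt p s)

/-- The ternary tree of scale 1. -/
def oneTree : TTree := .node .leaf .leaf .leaf

/-- Normalize a candidate pairing function: act by `f` on the leaves of the couple with
trees `P`, `N`, and by the identity elsewhere. -/
def normalizePair (P N : TTree) (f : NodeId → NodeId) : NodeId → NodeId :=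
  fun x => if (cond x.1 P N).IsLeafPos x.2 then f x else x

/-- The transposition of `0` and `2` in `Fin 3`. -/
def swap02 : Fin 3 → Fin 3 := fun i => if i = 0 then 2 else if i = 2 then 0 else 1

/-- The new (raw) pairing after step A performed at the leaf pair `{l, l'}`; the children
of `l` are paired to the children of `l'` according to `σ` (which is `id` or `swap02`),
corresponding to the two possible (1,1)-mini couples. -/
def stepAPairRaw (f : NodeId → NodeId) (l l' : NodeId) (σ : Fin 3 → Fin 3) :
    NodeId → NodeId := fun x =>
  if x = (l.1, l.2 ++ [(0 : Fin 3)]) then (l'.1, l'.2 ++ [σ 0])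
  else if x = (l.1, l.2 ++ [(1 : Fin 3)]) then (l'.1, l'.2 ++ [σ 1])
  else if x = (l.1, l.2 ++ [(2 : Fin 3)]) then (l'.1, l'.2 ++ [σ 2])
  else if x = (l'.1, l'.2 ++ [σ 0]) then (l.1, l.2 ++ [(0 : Fin 3)])
  else if x = (l'.1, l'.2 ++ [σ 1]) then (l.1, l.2 ++ [(1 : Fin 3)])
  else if x = (l'.1, l'.2 ++ [σ 2]) then (l.1, l.2 ++ [(2 : Fin 3)])
  else f x

/-- Graft the tree `s` at the positions of `l` and of `l'` that lie on the side `c`. -/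
def graft2 (t : TTree) (c : Bool) (l l' : NodeId) (s : TTree) : TTree :=
  let t1 := if l.1 = c then t.replaceAt l.2 s else t
  if l'.1 = c then t1.replaceAt l'.2 s else t1

/-- Step A: `Q'` is obtained from `Q` by replacing a pair of paired leaves by a
(1,1)-mini couple. -/
def StepA (Q Q' : Couple) : Prop :=
  ∃ (l : NodeId) (σ : Fin 3 → Fin 3),
    Q.IsLeaf l ∧ (σ = id ∨ σ = swap02) ∧
    Q'.pos = graft2 Q.pos true l (Q.pair l) oneTree ∧
    Q'.neg = graft2 Q.neg false l (Q.pair l) oneTree ∧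
    Q'.pair = normalizePair Q'.pos Q'.neg (stepAPairRaw Q.pair l (Q.pair l) σ)

/-- The relative position (among the grandchildren) of the lone leaf of the mini tree with
parameters `(i, v)`. -/
def loneIdx (i : Fin 3) (v : Bool) : Fin 3 := if i = 1 then 1 else cond v 0 2

/-- The two leaf pairs (as relative positions) of the mini tree with parameters `(i, v)`:
`i` is the index of the child of the root which is a branching node, and `v` selects one of
the two admissible pairings; together `(i, v)` ranges over the six possible mini trees. -/
def bPairs (i : Fin 3) (v : Bool) : (Pos × Pos) × (Pos × Pos) :=
  if i = 1 then
    cond v ((([0], [1, 2]), ([2], [1, 0]))) ((([0], [1, 0]), ([2], [1, 2])))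
  else if i = 0 then
    (([2], [0, 1]), cond v ([1], [0, 2]) ([1], [0, 0]))
  else
    (([0], [2, 1]), cond v ([1], [2, 2]) ([1], [2, 0]))

/-- The branching child of the root of a mini tree: the subtree `S` is reattached at the
lone leaf (grandchild number `lone`). -/
def gchildT (lone : Fin 3) (S : TTree) : TTree :=
  .node (if lone = 0 then S else .leaf) (if lone = 1 then S else .leaf)
    (if lone = 2 then S else .leaf)

/-- The mini tree with branching child in position `i` and the subtree `S` reattached at the
lone leaf (grandchild number `lone`). -/
def miniT (i lone : Fin 3) (S : TTree) : TTree :=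
  .node (if i = 0 then gchildT lone S else .leaf) (if i = 1 then gchildT lone S else .leaf)
    (if i = 2 then gchildT lone S else .leaf)

/-- Relabelling of positions under step B performed at `(c, q)`: nodes below `q` on side `c`
move below the lone leaf `q ++ [i, lone]`. -/
def bump (c : Bool) (q : Pos) (i lone : Fin 3) (x : NodeId) : NodeId :=
  if x.1 = c ∧ q <+: x.2 then (x.1, q ++ i :: lone :: x.2.drop q.length) else x

/-- The new (raw) pairing after step B performed at `(c, q)` with mini tree parameters
`(i, v)`. -/
def stepBPairRaw (f : NodeId → NodeId) (c : Bool) (q : Pos) (i : Fin 3) (v : Bool) :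
    NodeId → NodeId := fun x =>
  if x = (c, q ++ (bPairs i v).1.1) then (c, q ++ (bPairs i v).1.2)
  else if x = (c, q ++ (bPairs i v).1.2) then (c, q ++ (bPairs i v).1.1)
  else if x = (c, q ++ (bPairs i v).2.1) then (c, q ++ (bPairs i v).2.2)
  else if x = (c, q ++ (bPairs i v).2.2) then (c, q ++ (bPairs i v).2.1)
  else if x.1 = c ∧ (q ++ [i, loneIdx i v]) <+: x.2 then
    bump c q i (loneIdx i v) (f (c, q ++ x.2.drop (q.length + 2)))
  else bump c q i (loneIdx i v) (f x)

/-- Step B performed at the node `(c, q)` with mini tree parameters `(i, v)`: the node is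
replaced by a mini tree, the subtree originally rooted there being reattached at the lone
leaf of the mini tree. -/
def StepBAt (Q Q' : Couple) (c : Bool) (q : Pos) (i : Fin 3) (v : Bool) : Prop :=
  ∃ S : TTree, (Q.treeOf c).subtreeAt? q = some S ∧
    Q'.treeOf c = (Q.treeOf c).replaceAt q (miniT i (loneIdx i v) S) ∧
    Q'.treeOf (!c) = Q.treeOf (!c) ∧
    Q'.pair = normalizePair Q'.pos Q'.neg (stepBPairRaw Q.pair c q i v)

/-- Step B: `Q'` is obtained from `Q` by replacing some node by a mini tree. -/
def StepB (Q Q' : Couple) : Prop := ∃ c q i v, StepBAt Q Q' c q i v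

/-- One application of step A or step B. -/
def Step (Q Q' : Couple) : Prop := StepA Q Q' ∨ StepB Q Q'

/-- A regular couple: one obtained from the trivial couple by finitely many applications of
steps A and B. -/
def Regular (Q : Couple) : Prop := Relation.ReflTransGen Step trivialCouple Q

/-- A prime couple: one that cannot be obtained from any other couple by one application of
step A or step B. -/
def IsPrime (Q : Couple) : Prop := ¬ ∃ Q' : Couple, Q' ≠ Q ∧ Step Q' Q

/-- `Qsk` is a skeleton of `Q`: it is prime and `Q` is obtained from it by finitely many
applications of steps A and B. -/
def HasSkeleton (Q Qsk : Couple) : Prop :=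
  IsPrime Qsk ∧ Relation.ReflTransGen Step Qsk Q

/-! ### Labelled ternary trees -/

/-- Ternary trees with labelled leaves. -/
inductive LT (α : Type) : Type where
  | leaf : α → LT α
  | node : (Fin 3 → LT α) → LT α

namespace LT

variable {α : Type}

/-- Subtree at a position. -/
def get : LT α → Pos → Option (LT α)
  | t, [] => some t
  | .leaf _, _ :: _ => none
  | .node f, j :: p => (f j).get p

/-- Replace the subtree at a position. -/
def set : LT α → Pos → LT α → LT α
  | _, [], s => s
  | .leaf a, _ :: _, _ => .leaf a
  | .node f, j :: p, s => .node (Function.update f j ((f j).set p s))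

/-- Forget the labels. -/
def shape : LT α → TTree
  | .leaf _ => .leaf
  | .node f => .node (f 0).shape (f 1).shape (f 2).shape

/-- Number of branching nodes. -/
def size : LT α → ℕ
  | .leaf _ => 0
  | .node f => (f 0).size + (f 1).size + (f 2).size + 1

@[simp] theorem get_nil (t : LT α) : t.get [] = some t := by cases t <;> rfl
@[simp] theorem get_leaf_cons (a : α) (j : Fin 3) (p : Pos) :
    (LT.leaf a).get (j :: p) = none := rfl
@[simp] theorem get_node_cons (f : Fin 3 → LT α) (j : Fin 3) (p : Pos) :
    (LT.node f).get (j :: p) = (f j).get p := rfl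
@[simp] theorem set_nil (t s : LT α) : t.set [] s = s := by cases t <;> rfl
@[simp] theorem set_leaf_cons (a : α) (j : Fin 3) (p : Pos) (s : LT α) :
    (LT.leaf a).set (j :: p) s = LT.leaf a := rfl
@[simp] theorem set_node_cons (f : Fin 3 → LT α) (j : Fin 3) (p : Pos) (s : LT α) :
    (LT.node f).set (j :: p) s = .node (Function.update f j ((f j).set p s)) := rfl

theorem get_append (t : LT α) (p r : Pos) :
    t.get (p ++ r) = (t.get p).bind (fun u => u.get r) := by
  induction p generalizing t with
  | nil => simp
  | cons j p ih => cases t <;> simp [ih]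

theorem get_set_below (t s u : LT α) (p r : Pos) (h : t.get p = some u) :
    (t.set p s).get (p ++ r) = s.get r := by
  induction p generalizing t with
  | nil => simp
  | cons j p ih =>
    cases t with
    | leaf a => simp at h
    | node f => simpa using ih _ (by simpa using h)

theorem get_set_disj (t s : LT α) (p r : Pos) (h1 : ¬ p <+: r) (h2 : ¬ r <+: p) :
    (t.set p s).get r = t.get r := by
  induction p generalizing t r with
  | nil => simp at h1
  | cons j p ih =>
    cases r with
    | nil => simp at h2
    | cons k r =>
      cases t with
      | leaf a => simp
      | node f =>
        by_cases hjk : k = j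
        · subst hjk
          simp only [List.cons_prefix_cons, true_and] at h1 h2
          simpa using ih _ _ h1 h2
        · simp [hjk]

theorem set_set_disj (t s s' : LT α) (p r : Pos) (h1 : ¬ p <+: r) (h2 : ¬ r <+: p) :
    (t.set p s).set r s' = (t.set r s').set p s := by
  induction p generalizing t r with
  | nil => simp at h1
  | cons j p ih =>
    cases r with
    | nil => simp at h2
    | cons k r =>
      cases t with
      | leaf a => simp
      | node f =>
        by_cases hjk : k = j
        · subst hjk
          simp only [List.cons_prefix_cons, true_and] at h1 h2
          simp [ih (f k) _ h1 h2]
        · have : j ≠ k := fun h => hjk h.symm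
          simp only [set_node_cons, ne_eq, hjk, not_false_eq_true, Function.update_of_ne, this]
          rw [Function.update_comm this]

theorem set_set_same (t s s' : LT α) (p : Pos) : (t.set p s).set p s' = t.set p s' := by
  induction p generalizing t with
  | nil => simp
  | cons j p ih => cases t <;> simp [ih]

theorem set_append (t s u : LT α) (p r : Pos) (h : t.get p = some u) :
    t.set (p ++ r) s = t.set p (u.set r s) := by
  induction p generalizing t with
  | nil => simp at h; simp [h]
  | cons j p ih =>
    cases t with
    | leaf a => simp at h
    | node f => simp [ih (f j) (by simpa using h)]

theorem set_get (t u : LT α) (p : Pos) (h : t.get p = some u) : t.set p u = t := by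
  induction p generalizing t with
  | nil => simp at h; simp [h]
  | cons j p ih =>
    cases t with
    | leaf a => simp at h
    | node f => simp [ih (f j) (by simpa using h)]

theorem shape_get (t : LT α) (p : Pos) : t.shape.subtreeAt? p = (t.get p).map shape := by
  induction p generalizing t with
  | nil => cases t <;> simp [TTree.subtreeAt?]
  | cons j p ih =>
    cases t with
    | leaf a => simp [TTree.subtreeAt?, shape]
    | node f => fin_cases j <;> simp [TTree.subtreeAt?, shape, ih]

theorem shape_set (t s : LT α) (p : Pos) : (t.set p s).shape = t.shape.replaceAt p s.shape := by
  induction p generalizing t with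
  | nil => cases t <;> simp [TTree.replaceAt]
  | cons j p ih =>
    cases t with
    | leaf a => simp [TTree.replaceAt, shape]
    | node f => fin_cases j <;> simp [TTree.replaceAt, shape, ih]

theorem shape_eq_leaf (t : LT α) : t.shape = .leaf ↔ ∃ a, t = .leaf a := by
  cases t <;> simp [shape]

theorem size_eq (t : LT α) : t.shape.scale = t.size := by
  induction t with
  | leaf a => rfl
  | node f ih => simp [shape, TTree.scale, size, ih]

theorem size_set (t s u : LT α) (p : Pos) (h : t.get p = some u) :
    (t.set p s).size + u.size = t.size + s.size := by
  induction p generalizing t with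
  | nil => simp at h; subst h; simp; omega
  | cons j p ih =>
    cases t with
    | leaf a => simp at h
    | node f =>
      have := ih (f j) (by simpa using h)
      fin_cases j <;> simp [size] at this ⊢ <;> omega

theorem size_get_le (t u : LT α) (p : Pos) (h : t.get p = some u) : u.size ≤ t.size := by
  induction p generalizing t with
  | nil => simp at h; subst h; simp
  | cons j p ih =>
    cases t with
    | leaf a => simp at h
    | node f =>
      have := ih (f j) (by simpa using h)
      fin_cases j <;> simp [size] at this ⊢ <;> omega

theorem size_get_lt (t u : LT α) (j : Fin 3) (p : Pos) (h : t.get (j :: p) = some u) :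
    u.size < t.size := by
  cases t with
  | leaf a => simp at h
  | node f =>
    have := size_get_le (f j) u p (by simpa using h)
    fin_cases j <;> simp [size] at this ⊢ <;> omega

/-- Label the leaves of a tree by a function of the position. -/
def ofFn : TTree → (Pos → α) → LT α
  | .leaf, f => .leaf (f [])
  | .node a b c, f => .node (fun j =>
      if j = 0 then ofFn a (fun p => f (0 :: p)) else
      if j = 1 then ofFn b (fun p => f (1 :: p)) else ofFn c (fun p => f (2 :: p)))

theorem shape_ofFn (t : TTree) (f : Pos → α) : (ofFn t f).shape = t := by
  induction t generalizing f with
  | leaf => rfl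
  | node a b c iha ihb ihc => simp [ofFn, shape, iha, ihb, ihc]

theorem get_ofFn (t : TTree) (f : Pos → α) (p : Pos) (a : α)
    (h : (ofFn t f).get p = some (.leaf a)) : a = f p := by
  induction p generalizing t f with
  | nil => cases t <;> simp [ofFn] at h; simp [h]
  | cons j p ih =>
    cases t with
    | leaf => simp [ofFn] at h
    | node a b c =>
      fin_cases j <;> simp [ofFn] at h <;> simpa using ih _ _ h

end LT

/-! ### Pairs of labelled trees -/

section pairs

variable {α : Type}

/-- Subtree at a node of a pair of trees. -/
def gt (T : Bool → LT α) (x : NodeId) : Option (LT α) := (T x.1).get x.2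

/-- Replace the subtree at a node of a pair of trees. -/
def st (T : Bool → LT α) (x : NodeId) (s : LT α) : Bool → LT α :=
  Function.update T x.1 ((T x.1).set x.2 s)

/-- Descendant of a node. -/
def ap (x : NodeId) (p : Pos) : NodeId := (x.1, x.2 ++ p)

/-- `y` is a descendant of `x`. -/
def Below (x y : NodeId) : Prop := ∃ p, y = ap x p

/-- Incomparable nodes. -/
def Disj (x y : NodeId) : Prop := ¬ Below x y ∧ ¬ Below y x

theorem below_iff (x y : NodeId) : Below x y ↔ y.1 = x.1 ∧ x.2 <+: y.2 := by
  constructor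
  · rintro ⟨p, rfl⟩; exact ⟨rfl, p, rfl⟩
  · rintro ⟨h, p, hp⟩; exact ⟨p, Prod.ext h hp.symm⟩

@[simp] theorem ap_nil (x : NodeId) : ap x [] = x := by simp [ap]
theorem ap_ap (x : NodeId) (p r : Pos) : ap (ap x p) r = ap x (p ++ r) := by simp [ap]
@[simp] theorem ap_inj (x : NodeId) (p r : Pos) : ap x p = ap x r ↔ p = r := by simp [ap]
theorem ap_single (x y : NodeId) (i j : Fin 3) : ap x [i] = ap y [j] ↔ x = y ∧ i = j := by
  constructor
  · intro h
    simp only [ap, Prod.mk.injEq] at h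
    obtain ⟨h1, h2⟩ := h
    have := List.append_inj' h2 rfl
    exact ⟨Prod.ext h1 this.1, by simpa using this.2⟩
  · rintro ⟨rfl, rfl⟩; rfl

@[simp] theorem ap_eq_self (x : NodeId) (p : Pos) : ap x p = x ↔ p = [] := by
  have := ap_inj x p []
  rwa [ap_nil] at this

@[simp] theorem self_eq_ap (x : NodeId) (p : Pos) : x = ap x p ↔ p = [] := by
  rw [eq_comm, ap_eq_self]

theorem Disj.symm {x y : NodeId} (h : Disj x y) : Disj y x := ⟨h.2, h.1⟩

theorem below_ap (x y : NodeId) (p : Pos) (h : Below x y) : Below x (ap y p) := by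
  obtain ⟨r, rfl⟩ := h; exact ⟨r ++ p, ap_ap _ _ _⟩

theorem below_total (x y z : NodeId) (h : Below x z) (h' : Below y z) :
    Below x y ∨ Below y x := by
  rw [below_iff] at *
  rw [below_iff]
  rcases List.prefix_or_prefix_of_prefix h.2 h'.2 with h2 | h2
  · exact Or.inl ⟨by rw [← h.1, h'.1], h2⟩
  · exact Or.inr ⟨by rw [← h.1, h'.1], h2⟩

theorem Disj.ap_left {x y : NodeId} (p : Pos) (h : Disj x y) : Disj (ap x p) y := by
  constructor
  · rintro ⟨r, rfl⟩; exact h.1 ⟨p ++ r, ap_ap _ _ _⟩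
  · intro h'
    rcases below_total x y (ap x p) ⟨p, rfl⟩ h' with h2 | h2
    · exact h.1 h2
    · exact h.2 h2

theorem Disj.ap_right {x y : NodeId} (p : Pos) (h : Disj x y) : Disj x (ap y p) :=
  (h.symm.ap_left p).symm

theorem below_ap_ap (x : NodeId) (p r : Pos) : Below (ap x p) (ap x r) ↔ p <+: r := by
  rw [below_iff]; simp [ap]

theorem disj_ap_ap (x : NodeId) (p r : Pos) (h1 : ¬ p <+: r) (h2 : ¬ r <+: p) :
    Disj (ap x p) (ap x r) := ⟨by rwa [below_ap_ap], by rwa [below_ap_ap]⟩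

theorem gt_ap (T : Bool → LT α) (x : NodeId) (p : Pos) :
    gt T (ap x p) = (gt T x).bind (fun u => u.get p) := LT.get_append _ _ _

theorem gt_ap_some {T : Bool → LT α} {x : NodeId} {u : LT α} (h : gt T x = some u) (p : Pos) :
    gt T (ap x p) = u.get p := by rw [gt_ap, h]; rfl

theorem gt_some_of_ap {T : Bool → LT α} {x : NodeId} {p : Pos} {u : LT α}
    (h : gt T (ap x p) = some u) : ∃ w, gt T x = some w ∧ w.get p = some u := by
  rw [gt_ap] at h
  cases hx : gt T x with
  | none => simp [hx] at h
  | some w => exact ⟨w, rfl, by simpa [hx] using h⟩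

theorem gt_st_ap {T : Bool → LT α} {x : NodeId} {u : LT α} (h : gt T x = some u) (s : LT α)
    (p : Pos) : gt (st T x s) (ap x p) = s.get p := by
  simp only [gt, st, ap, Function.update_self]
  exact LT.get_set_below _ _ _ _ _ h

theorem gt_st_same {T : Bool → LT α} {x : NodeId} {u : LT α} (h : gt T x = some u) (s : LT α) :
    gt (st T x s) x = some s := by
  simpa using gt_st_ap h s []

theorem gt_st_disj (T : Bool → LT α) {x y : NodeId} (s : LT α) (h : Disj x y) :
    gt (st T x s) y = gt T y := by
  obtain ⟨b, p⟩ := x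
  obtain ⟨c, r⟩ := y
  simp only [Disj, below_iff] at h
  simp only [gt, st]
  by_cases hc : c = b
  · subst hc
    simp only [true_and] at h
    simp only [Function.update_self]
    exact LT.get_set_disj _ _ _ _ h.1 h.2
  · simp [hc]

theorem st_comm (T : Bool → LT α) {x y : NodeId} (s s' : LT α) (h : Disj x y) :
    st (st T x s) y s' = st (st T y s') x s := by
  obtain ⟨b, p⟩ := x
  obtain ⟨c, r⟩ := y
  simp only [Disj, below_iff] at h
  simp only [st]
  by_cases hc : c = b
  · subst hc
    simp only [true_and] at h
    simp only [Function.update_self, Function.update_idem]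
    rw [LT.set_set_disj _ _ _ _ _ h.1 h.2]
  · have : b ≠ c := fun h => hc h.symm
    simp only [ne_eq, hc, not_false_eq_true, Function.update_of_ne, this]
    rw [Function.update_comm this]

theorem st_st_same (T : Bool → LT α) (x : NodeId) (s s' : LT α) :
    st (st T x s) x s' = st T x s' := by
  simp [st, LT.set_set_same]

theorem st_ap {T : Bool → LT α} {x : NodeId} {u : LT α} (h : gt T x = some u) (s : LT α)
    (p : Pos) : st T (ap x p) s = st T x (u.set p s) := by
  simp only [st, ap]
  rw [LT.set_append _ _ _ _ _ h]

theorem st_get {T : Bool → LT α} {x : NodeId} {u : LT α} (h : gt T x = some u) :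
    st T x u = T := by
  simp only [st]
  rw [LT.set_get _ _ _ h]; simp

/-- A leaf has no proper descendants. -/
theorem leaf_below {T : Bool → LT α} {x : NodeId} {p : Pos} {a : α} {u : LT α}
    (h : gt T x = some (.leaf a)) (h' : gt T (ap x p) = some u) : p = [] := by
  rw [gt_ap_some h] at h'
  cases p with
  | nil => rfl
  | cons j p => simp at h'

/-- Two pairs of trees have the same shape. -/
def SameShape (T T' : Bool → LT α) : Prop := ∀ c, (T c).shape = (T' c).shape

theorem SameShape.st {T T' : Bool → LT α} (h : SameShape T T') (x : NodeId) {s s' : LT α}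
    (hs : s.shape = s'.shape) : SameShape (st T x s) (st T' x s') := by
  intro c
  by_cases hc : c = x.1
  · subst hc; simp [WKE.st, LT.shape_set, h x.1, hs]
  · simp [WKE.st, hc, h c]

theorem SameShape.gt {T T' : Bool → LT α} (h : SameShape T T') {x : NodeId} {u : LT α}
    (hu : gt T' x = some u) : ∃ w, gt T x = some w ∧ w.shape = u.shape := by
  have h1 := LT.shape_get (T x.1) x.2
  have h2 := LT.shape_get (T' x.1) x.2
  rw [h x.1, h2] at h1
  change Option.map _ (WKE.gt T' x) = Option.map _ (WKE.gt T x) at h1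
  rw [hu] at h1
  cases hx : WKE.gt T x with
  | none => simp [hx] at h1
  | some w => exact ⟨w, rfl, by simpa [hx] using h1.symm⟩

theorem SameShape.leaf {T T' : Bool → LT α} (h : SameShape T T') {x : NodeId} {a : α}
    (hu : WKE.gt T' x = some (.leaf a)) : ∃ b, WKE.gt T x = some (.leaf b) := by
  obtain ⟨w, hw, hs⟩ := h.gt hu
  obtain ⟨b, rfl⟩ := (LT.shape_eq_leaf w).1 hs
  exact ⟨b, hw⟩

/-- Total size. -/
def tsize (T : Bool → LT α) : ℕ := (T true).size + (T false).size

theorem tsize_st {T : Bool → LT α} {x : NodeId} {u : LT α} (h : gt T x = some u) (s : LT α) :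
    tsize (st T x s) + u.size = tsize T + s.size := by
  have := LT.size_set _ s u _ h
  obtain ⟨b, p⟩ := x
  cases b <;> simp [tsize, st] at this ⊢ <;> omega

end pairs

/-! ### Redexes of labelled trees -/

section redex

variable {α : Type}

theorem bp (i : Fin 3) (v : Bool) : ∃ j1 j2 k1 k2 : Fin 3,
    bPairs i v = (([j1], [i, k1]), ([j2], [i, k2])) ∧ j1 ≠ i ∧ j2 ≠ i ∧ j1 ≠ j2 ∧
    k1 ≠ loneIdx i v ∧ k2 ≠ loneIdx i v ∧ k1 ≠ k2 ∧ (∀ j, j = i ∨ j = j1 ∨ j = j2) ∧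
    (∀ k, k = loneIdx i v ∨ k = k1 ∨ k = k2) := by
  revert i v; decide

/-- The node `q` is the root of a mini tree with parameters `(i, v)`, the lone leaf carrying `S`. -/
def RedB (T : Bool → LT α) (q : NodeId) (i : Fin 3) (v : Bool) (S : LT α) : Prop :=
  ∃ a b, gt T (ap q (bPairs i v).1.1) = some (.leaf a) ∧
    gt T (ap q (bPairs i v).1.2) = some (.leaf a) ∧
    gt T (ap q (bPairs i v).2.1) = some (.leaf b) ∧
    gt T (ap q (bPairs i v).2.2) = some (.leaf b) ∧
    gt T (ap q [i, loneIdx i v]) = some S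

/-- The nodes `x`, `y` are the roots of a (1,1)-mini couple, whose middle label is `b`. -/
def RedA (T : Bool → LT α) (x y : NodeId) (b : α) : Prop :=
  x ≠ y ∧ ∃ (σ : Fin 3 → Fin 3) (l : Fin 3 → α), (σ = id ∨ σ = swap02) ∧ l 1 = b ∧
    ∀ j, gt T (ap x [j]) = some (.leaf (l j)) ∧ gt T (ap y [σ j]) = some (.leaf (l j))

/-- Reverse steps on labelled trees. -/
def Red (T T1 : Bool → LT α) : Prop :=
  (∃ x y b, RedA T x y b ∧ T1 = st (st T x (.leaf b)) y (.leaf b)) ∨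
  (∃ q i v S, RedB T q i v S ∧ T1 = st T q S)

/-- Every label occurs at most twice. -/
def Lin (T : Bool → LT α) : Prop := ∀ x y z a, gt T x = some (.leaf a) →
  gt T y = some (.leaf a) → gt T z = some (.leaf a) → x = y ∨ x = z ∨ y = z

/-- Positions which survive a reverse step B at `q`. -/
def Ok (q y : NodeId) : Prop := Below q y ∨ Disj q y

/-- `bump` for nodes. -/
def bmp (q : NodeId) (i k : Fin 3) (x : NodeId) : NodeId := bump q.1 q.2 i k x

theorem bmp_ap (q : NodeId) (i k : Fin 3) (p : Pos) : bmp q i k (ap q p) = ap q (i :: k :: p) := by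
  simp [bmp, bump, ap]

theorem bmp_not (q : NodeId) (i k : Fin 3) (y : NodeId) (h : ¬ Below q y) : bmp q i k y = y := by
  rw [below_iff] at h
  simp only [bmp, bump, if_neg h]

theorem Ok.ap {q y : NodeId} (h : Ok q y) (p : Pos) : Ok q (ap y p) :=
  h.elim (fun h => Or.inl (below_ap _ _ _ h)) (fun h => Or.inr (h.ap_right p))

theorem Ok.bmp_ap {q y : NodeId} (h : Ok q y) (i k : Fin 3) (p : Pos) :
    bmp q i k (WKE.ap y p) = WKE.ap (bmp q i k y) p := by
  rcases h with ⟨r, rfl⟩ | h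
  · simp [ap_ap, WKE.bmp_ap]
  · rw [bmp_not _ _ _ _ h.1, bmp_not _ _ _ _ (h.ap_right p).1]

theorem bmp_inj (q : NodeId) (i k : Fin 3) (y z : NodeId) (h : bmp q i k y = bmp q i k z) :
    y = z := by
  by_cases hy : Below q y <;> by_cases hz : Below q z
  · obtain ⟨p, rfl⟩ := hy
    obtain ⟨r, rfl⟩ := hz
    simp only [bmp_ap, ap_inj, List.cons.injEq, true_and] at h
    rw [h]
  · obtain ⟨p, rfl⟩ := hy
    rw [bmp_ap, bmp_not _ _ _ _ hz] at h
    exact absurd ⟨_, h.symm⟩ hz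
  · obtain ⟨p, rfl⟩ := hz
    rw [bmp_ap, bmp_not _ _ _ _ hy] at h
    exact absurd ⟨_, h⟩ hy
  · rwa [bmp_not _ _ _ _ hz, bmp_not _ _ _ _ hy] at h

theorem RedB.root {T : Bool → LT α} {q i v S} (h : RedB T q i v S) :
    ∃ u, gt T q = some u ∧ u.get [i, loneIdx i v] = some S := by
  obtain ⟨a, b, -, -, -, -, h⟩ := h
  exact gt_some_of_ap h

theorem RedB.gt_bmp {T : Bool → LT α} {q i v S} (h : RedB T q i v S) {y : NodeId} (hy : Ok q y) :
    gt (st T q S) y = gt T (bmp q i (loneIdx i v) y) := by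
  obtain ⟨u, hu, hS⟩ := h.root
  rcases hy with ⟨p, rfl⟩ | hy
  · rw [gt_st_ap hu, bmp_ap, gt_ap_some hu]
    have := LT.get_append u [i, loneIdx i v] p
    rw [hS] at this
    simpa using this.symm
  · rw [bmp_not _ _ _ _ hy.1, gt_st_disj _ _ hy]

theorem RedB.resid {T : Bool → LT α} {q i v S} (h : RedB T q i v S) {y : NodeId} (hy : Ok q y)
    (t : LT α) : ∃ S', RedB (st T (bmp q i (loneIdx i v) y) t) q i v S' ∧
      st (st T (bmp q i (loneIdx i v) y) t) q S' = st (st T q S) y t := by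
  obtain ⟨u, hu, hS⟩ := h.root
  obtain ⟨a, b, h1, h2, h3, h4, h5⟩ := h
  rcases hy with ⟨p, rfl⟩ | hy
  · refine ⟨S.set p t, ⟨a, b, ?_⟩, ?_⟩
    · obtain ⟨j1, j2, k1, k2, hb, g1, g2, g3, g4, g5, g6, g7, g8⟩ := bp i v
      rw [hb] at h1 h2 h3 h4 ⊢
      simp only at h1 h2 h3 h4 ⊢
      rw [bmp_ap]
      refine ⟨?_, ?_, ?_, ?_, ?_⟩
      · rwa [gt_st_disj]
        apply disj_ap_ap <;> simp [g1, g1.symm]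
      · rwa [gt_st_disj]
        apply disj_ap_ap <;> simp [g4, g4.symm]
      · rwa [gt_st_disj]
        apply disj_ap_ap <;> simp [g2, g2.symm]
      · rwa [gt_st_disj]
        apply disj_ap_ap <;> simp [g5, g5.symm]
      · have e : ap q (i :: loneIdx i v :: p) = ap (ap q [i, loneIdx i v]) p := by simp [ap_ap]
        rw [e, st_ap h5, gt_st_same h5]
    · rw [bmp_ap, st_ap hu, st_st_same]
      have : gt (st T q S) q = some S := gt_st_same hu S
      rw [st_ap this, st_st_same]
  · rw [bmp_not _ _ _ _ hy.1]
    refine ⟨S, ⟨a, b, ?_⟩, ?_⟩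
    · refine ⟨?_, ?_, ?_, ?_, ?_⟩ <;> rw [gt_st_disj _ _ (hy.symm.ap_right _)] <;> assumption
    · exact st_comm _ _ _ hy.symm

theorem RedB.classify {T : Bool → LT α} {q i v S} (h : RedB T q i v S) {x : NodeId} {u : LT α}
    (hx : gt T x = some u) (hn : ∀ p, q = ap x p → p = []) :
    x = q ∨ x = ap q [i] ∨ x = ap q (bPairs i v).1.1 ∨ x = ap q (bPairs i v).1.2 ∨
    x = ap q (bPairs i v).2.1 ∨ x = ap q (bPairs i v).2.2 ∨
    ∃ y, Ok q y ∧ x = bmp q i (loneIdx i v) y := by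
  by_cases hq : Below q x
  · obtain ⟨p, rfl⟩ := hq
    obtain ⟨a, b, h1, h2, h3, h4, h5⟩ := h
    obtain ⟨j1, j2, k1, k2, hb, g1, g2, g3, g4, g5, g6, g7, g8⟩ := bp i v
    rw [hb] at h1 h2 h3 h4 ⊢
    simp only at h1 h2 h3 h4 ⊢
    match p with
    | [] => simp
    | [j] => rcases g7 j with rfl | rfl | rfl <;> simp
    | j :: k :: p =>
      rcases g7 j with rfl | rfl | rfl
      · rcases g8 k with rfl | rfl | rfl
        · right; right; right; right; right; right
          exact ⟨ap q p, Or.inl ⟨p, rfl⟩, (bmp_ap _ _ _ _).symm⟩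
        · have e : ap q (j :: k :: p) = ap (ap q [j, k]) p := by simp [ap_ap]
          rw [e] at hx
          have := leaf_below h2 hx
          subst this; simp
        · have e : ap q (j :: k :: p) = ap (ap q [j, k]) p := by simp [ap_ap]
          rw [e] at hx
          have := leaf_below h4 hx
          subst this; simp
      · have e : ap q (j :: k :: p) = ap (ap q [j]) (k :: p) := by simp [ap_ap]
        rw [e] at hx
        have := leaf_below h1 hx
        simp at this
      · have e : ap q (j :: k :: p) = ap (ap q [j]) (k :: p) := by simp [ap_ap]
        rw [e] at hx
        have := leaf_below h3 hx
        simp at this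
  · right; right; right; right; right; right
    refine ⟨x, Or.inr ⟨hq, ?_⟩, (bmp_not _ _ _ _ hq).symm⟩
    rintro ⟨p, rfl⟩
    have := hn p rfl
    subst this
    exact hq ⟨[], by simp⟩

theorem RedB.branch {T : Bool → LT α} {q i v S} (h : RedB T q i v S) :
    (∀ a, gt T q ≠ some (.leaf a)) ∧ (∀ a, gt T (WKE.ap q [i]) ≠ some (.leaf a)) := by
  obtain ⟨a, b, h1, h2, h3, h4, h5⟩ := h
  constructor
  · intro c hc
    have := leaf_below hc h5
    simp at this
  · intro c hc
    have e : WKE.ap q [i, loneIdx i v] = WKE.ap (WKE.ap q [i]) [loneIdx i v] := by simp [ap_ap]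
    rw [e] at h5
    have := leaf_below hc h5
    simp at this

/-- The leaf children of the root of a mini tree. -/
theorem RedB.child {T : Bool → LT α} {q i v S} (h : RedB T q i v S) {j : Fin 3} (hj : j ≠ i) :
    ∃ a k, gt T (ap q [j]) = some (.leaf a) ∧ gt T (ap q [i, k]) = some (.leaf a) := by
  obtain ⟨a, b, h1, h2, h3, h4, h5⟩ := h
  obtain ⟨j1, j2, k1, k2, hb, g1, g2, g3, g4, g5, g6, g7, g8⟩ := bp i v
  rw [hb] at h1 h2 h3 h4
  rcases g7 j with rfl | rfl | rfl
  · exact absurd rfl hj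
  · exact ⟨a, k1, h1, h2⟩
  · exact ⟨b, k2, h3, h4⟩

/-- The paired grandchildren in a mini tree. -/
theorem RedB.gchild {T : Bool → LT α} {q i v S} (h : RedB T q i v S) {k : Fin 3}
    (hk : k ≠ loneIdx i v) :
    ∃ a j, j ≠ i ∧ gt T (ap q [j]) = some (.leaf a) ∧ gt T (ap q [i, k]) = some (.leaf a) := by
  obtain ⟨a, b, h1, h2, h3, h4, h5⟩ := h
  obtain ⟨j1, j2, k1, k2, hb, g1, g2, g3, g4, g5, g6, g7, g8⟩ := bp i v
  rw [hb] at h1 h2 h3 h4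
  rcases g8 k with rfl | rfl | rfl
  · exact absurd rfl hk
  · exact ⟨a, j1, g1, h1, h2⟩
  · exact ⟨b, j2, g2, h3, h4⟩

theorem RedB.no_overlap {T : Bool → LT α} (hL : Lin T) {q i v S i2 v2 S2} (h : RedB T q i v S)
    (h2 : RedB T (ap q [i]) i2 v2 S2) : False := by
  -- pick a paired grandchild different from `i2`
  have hk : ∃ k, k ≠ loneIdx i v ∧ k ≠ i2 := by
    generalize loneIdx i v = m
    clear h2
    revert m i2; decide
  obtain ⟨k, hk1, hk2⟩ := hk
  obtain ⟨a, j, hj, e1, e2⟩ := h.gchild hk1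
  obtain ⟨b, m, e3, e4⟩ := h2.child hk2
  rw [ap_ap] at e3 e4
  simp only [List.cons_append, List.nil_append] at e3 e4
  rw [e2] at e3
  cases e3
  rcases hL _ _ _ _ e1 e2 e4 with h | h | h <;> simp at h

theorem RedB.same {T : Bool → LT α} (hL : Lin T) {q i v S i2 v2 S2} (h : RedB T q i v S)
    (hh : RedB T q i2 v2 S2) : S = S2 := by
  have hi : i = i2 := by
    by_contra hne
    obtain ⟨a, k, e1, -⟩ := hh.child hne
    exact h.branch.2 _ e1
  subst hi
  have hk : loneIdx i v = loneIdx i v2 := by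
    by_contra hne
    -- common paired grandchild leads to a third occurrence
    obtain ⟨a, b, h1, h2, h3, h4, h5⟩ := h
    obtain ⟨a', b', h1', h2', h3', h4', h5'⟩ := hh
    have : v2 = !v := by
      cases v <;> cases v2 <;> simp_all
    subst this
    have hi : i ≠ 1 := by
      rintro rfl
      simp [loneIdx] at hne
    have : (bPairs i v).2.1 = (bPairs i !v).2.1 ∧ (bPairs i v).2.2 ≠ (bPairs i !v).2.2 ∧
        (bPairs i v).2.1 ≠ (bPairs i v).2.2 ∧ (bPairs i v).2.1 ≠ (bPairs i !v).2.2 := by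
      clear * - hi
      revert i v; decide
    obtain ⟨g1, g2, g3, g4⟩ := this
    rw [← g1, h3] at h3'
    cases h3'
    rcases hL _ _ _ _ h3 h4 h4' with h | h | h <;> simp [g2, g3, g4] at h
  obtain ⟨a, b, h1, h2, h3, h4, h5⟩ := h
  obtain ⟨a', b', h1', h2', h3', h4', h5'⟩ := hh
  rw [hk, h5'] at h5
  cases h5; rfl

theorem swap02_swap02 (j : Fin 3) : swap02 (swap02 j) = j := by revert j; decide

theorem RedA.symm {T : Bool → LT α} {x y b} (h : RedA T x y b) : RedA T y x b := by
  obtain ⟨hne, σ, l, hσ, hb, h⟩ := h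
  refine ⟨hne.symm, σ, l ∘ σ, hσ, ?_, ?_⟩
  · rcases hσ with rfl | rfl
    · exact hb
    · exact hb
  · intro j
    have h1 := h j
    have h2 := h (σ j)
    rcases hσ with rfl | rfl
    · exact ⟨h1.2, h1.1⟩
    · rw [swap02_swap02] at h2
      exact ⟨h2.2, h2.1⟩

theorem RedA.child {T : Bool → LT α} {x y b} (h : RedA T x y b) (j : Fin 3) :
    ∃ a k, gt T (ap x [j]) = some (.leaf a) ∧ gt T (ap y [k]) = some (.leaf a) := by
  obtain ⟨hne, σ, l, hσ, hb, h⟩ := h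
  exact ⟨l j, σ j, (h j).1, (h j).2⟩

theorem RedA.mid {T : Bool → LT α} {x y b} (h : RedA T x y b) :
    gt T (ap x [1]) = some (.leaf b) ∧ gt T (ap y [1]) = some (.leaf b) := by
  obtain ⟨hne, σ, l, hσ, hb, h⟩ := h
  have := h 1
  rw [hb] at this
  rcases hσ with rfl | rfl <;> exact this

/-- Anything weakly below the root of a mini couple is the root or a leaf child. -/
theorem RedA.below {T : Bool → LT α} {x y b} (h : RedA T x y b) {p : Pos} {u : LT α}
    (hu : gt T (ap x p) = some u) : p = [] ∨ ∃ j a, p = [j] ∧ u = .leaf a := by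
  cases p with
  | nil => simp
  | cons j p =>
    obtain ⟨a, k, h1, h2⟩ := h.child j
    have e : ap x (j :: p) = ap (ap x [j]) p := by simp [ap_ap]
    rw [e] at hu
    have := leaf_below h1 hu
    subst this
    rw [ap_nil, h1] at hu
    cases hu
    exact Or.inr ⟨j, a, rfl, rfl⟩

theorem RedA.root {T : Bool → LT α} {x y b} (h : RedA T x y b) :
    ∃ u, gt T x = some u ∧ ∀ a, u ≠ .leaf a := by
  obtain ⟨u, h1, h2⟩ := gt_some_of_ap h.mid.1
  refine ⟨u, h1, ?_⟩
  rintro a rfl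
  simp at h2

theorem RedA.disj {T : Bool → LT α} {x y b x' y' b'} (h : RedA T x y b) (h' : RedA T x' y' b')
    (hne : x ≠ x') : Disj x x' := by
  obtain ⟨u, h1, h2⟩ := h.root
  obtain ⟨u', h1', h2'⟩ := h'.root
  constructor
  · rintro ⟨p, rfl⟩
    rcases h.below h1' with rfl | ⟨j, a, rfl, rfl⟩
    · simp at hne
    · exact h2' _ rfl
  · rintro ⟨p, rfl⟩
    rcases h'.below h1 with rfl | ⟨j, a, rfl, rfl⟩
    · simp at hne
    · exact h2 _ rfl

theorem RedA.disj' {T : Bool → LT α} {x y b} (h : RedA T x y b) : Disj x y :=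
  h.disj h.symm h.1

theorem RedA.stable {T : Bool → LT α} {x y b} (h : RedA T x y b) {z : NodeId} (t : LT α)
    (hx : Disj z x) (hy : Disj z y) : RedA (st T z t) x y b := by
  obtain ⟨hne, σ, l, hσ, hb, h⟩ := h
  refine ⟨hne, σ, l, hσ, hb, fun j => ?_⟩
  rw [gt_st_disj _ _ (hx.ap_right _), gt_st_disj _ _ (hy.ap_right _)]
  exact h j

theorem RedA.ok {T : Bool → LT α} (hL : Lin T) {x y b q i v S} (h : RedA T x y b)
    (h' : RedB T q i v S) : ∃ x', Ok q x' ∧ x = bmp q i (loneIdx i v) x' := by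
  obtain ⟨u, h1, h2⟩ := h.root
  have hbr := h'.branch
  obtain ⟨w, hw, hwS⟩ := h'.root
  have hqx : ∀ p, q = ap x p → p = [] := by
    rintro p rfl
    rcases h.below hw with rfl | ⟨j, a, rfl, rfl⟩
    · rfl
    · exact absurd hw (hbr.1 a)
  have key := h'.classify h1 hqx
  obtain ⟨a, b, e1, e2, e3, e4, e5⟩ := id h'
  rcases key with rfl | rfl | rfl | rfl | rfl | rfl | h3
  · obtain ⟨a, k, f1, f2⟩ := h.child i
    exact absurd f1 (hbr.2 a)
  · exfalso
    have hk : ∃ k, k ≠ loneIdx i v := by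
      generalize loneIdx i v = m
      revert m; decide
    obtain ⟨k, hk⟩ := hk
    obtain ⟨a, j, hj, f1, f2⟩ := h'.gchild hk
    obtain ⟨c, m, f3, f4⟩ := h.child k
    rw [ap_ap] at f3
    simp only [List.cons_append, List.nil_append] at f3
    rw [f2] at f3
    cases f3
    rcases hL _ _ _ _ f1 f2 f4 with g | g | g
    · simp at g
    · rw [ap_single] at g
      obtain ⟨rfl, -⟩ := g
      obtain ⟨a, k, f1, f2⟩ := h.symm.child i
      exact absurd f1 (hbr.2 a)
    · have : ap q [i, k] = ap (ap q [i]) [k] := by simp [ap_ap]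
      rw [this, ap_single] at g
      exact h.1 g.1
  · rw [e1] at h1; cases h1; exact absurd rfl (h2 _)
  · rw [e2] at h1; cases h1; exact absurd rfl (h2 _)
  · rw [e3] at h1; cases h1; exact absurd rfl (h2 _)
  · rw [e4] at h1; cases h1; exact absurd rfl (h2 _)
  · exact h3

theorem diamond_AB {T : Bool → LT α} (hL : Lin T) {x y b q i v S} (h : RedA T x y b)
    (h' : RedB T q i v S) :
    ∃ T0, Red (st (st T x (.leaf b)) y (.leaf b)) T0 ∧ Red (st T q S) T0 := by
  obtain ⟨x', hx', rfl⟩ := h.ok hL h'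
  obtain ⟨y', hy', rfl⟩ := h.symm.ok hL h'
  obtain ⟨S1, r1, e1⟩ := h'.resid hx' (.leaf b)
  obtain ⟨S2, r2, e2⟩ := r1.resid hy' (.leaf b)
  refine ⟨_, Or.inr ⟨q, i, v, S2, r2, rfl⟩, Or.inl ⟨x', y', b, ?_, ?_⟩⟩
  · obtain ⟨hne, σ, l, hσ, hb, h⟩ := h
    refine ⟨?_, σ, l, hσ, hb, ?_⟩
    · rintro rfl; exact hne rfl
    · intro j
      rw [h'.gt_bmp (hx'.ap _), h'.gt_bmp (hy'.ap _), hx'.bmp_ap, hy'.bmp_ap]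
      exact h j
  · rw [e2, e1]

theorem diamond_AA {T : Bool → LT α} (hL : Lin T) {x y b x' y' b'} (h : RedA T x y b)
    (h' : RedA T x' y' b') :
    st (st T x (.leaf b)) y (.leaf b) = st (st T x' (.leaf b')) y' (.leaf b') ∨
    ∃ T0, Red (st (st T x (.leaf b)) y (.leaf b)) T0 ∧
      Red (st (st T x' (.leaf b')) y' (.leaf b')) T0 := by
  -- a shared root forces equality
  have shared : ∀ {x y b x' y' b'}, RedA T x y b → RedA T x' y' b' → x = x' → y = y' ∧ b = b' := by
    intro x y b x' y' b' h h' hx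
    subst hx
    have m := h.mid
    have m' := h'.mid
    have hb : b = b' := by
      have := m.1.symm.trans m'.1
      cases this; rfl
    subst hb
    refine ⟨?_, rfl⟩
    rcases hL _ _ _ _ m.1 m.2 m'.2 with g | g | g <;> rw [ap_single] at g
    · exact absurd g.1 h.1
    · exact absurd g.1 h'.1
    · exact g.1
  by_cases h1 : x = x'
  · obtain ⟨rfl, rfl⟩ := shared h h' h1
    subst h1; left; rfl
  by_cases h2 : x = y'
  · obtain ⟨rfl, rfl⟩ := shared h h'.symm h2
    subst h2; left
    exact st_comm _ _ _ h.disj'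
  by_cases h3 : y = x'
  · exact absurd (shared h.symm h' h3).1 h2
  by_cases h4 : y = y'
  · exact absurd (shared h.symm h'.symm h4).1 h1
  right
  have d1 := h.disj h' h1
  have d2 := h.disj h'.symm h2
  have d3 := h.symm.disj h' h3
  have d4 := h.symm.disj h'.symm h4
  refine ⟨_, Or.inl ⟨x', y', b', (h'.stable _ d1 d2).stable _ d3 d4, rfl⟩,
    Or.inl ⟨x, y, b, (h.stable _ d1.symm d3.symm).stable _ d2.symm d4.symm, ?_⟩⟩
  rw [st_comm _ _ _ d3, st_comm _ _ _ d1, st_comm _ _ _ d4, st_comm _ _ _ d2]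

theorem diamond_BB {T : Bool → LT α} (hL : Lin T) {q i v S q' i' v' S'} (h : RedB T q i v S)
    (h' : RedB T q' i' v' S') (hn : ∀ p, q = ap q' p → p = []) :
    st T q S = st T q' S' ∨ ∃ T0, Red (st T q S) T0 ∧ Red (st T q' S') T0 := by
  obtain ⟨u, hu, -⟩ := h'.root
  have hbr := h'.branch.1
  have key := h.classify hu hn
  obtain ⟨a, b, e1, e2, e3, e4, e5⟩ := id h
  rcases key with rfl | rfl | rfl | rfl | rfl | rfl | ⟨y, hy, rfl⟩
  · rw [h.same hL h']; left; rfl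
  · exact (h.no_overlap hL h').elim
  · exact absurd e1 (hbr _)
  · exact absurd e2 (hbr _)
  · exact absurd e3 (hbr _)
  · exact absurd e4 (hbr _)
  · right
    obtain ⟨S1, r1, f1⟩ := h.resid hy S'
    refine ⟨_, Or.inr ⟨y, i', v', S', ?_, rfl⟩, Or.inr ⟨q, i, v, S1, r1, f1.symm⟩⟩
    obtain ⟨a, b, h1, h2, h3, h4, h5⟩ := h'
    refine ⟨a, b, ?_, ?_, ?_, ?_, ?_⟩ <;> rw [h.gt_bmp (hy.ap _), hy.bmp_ap] <;> assumption

theorem diamond_red {T T1 T2 : Bool → LT α} (hL : Lin T) (h1 : Red T T1) (h2 : Red T T2) :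
    T1 = T2 ∨ ∃ T0, Red T1 T0 ∧ Red T2 T0 := by
  rcases h1 with ⟨x, y, b, h1, rfl⟩ | ⟨q, i, v, S, h1, rfl⟩ <;>
  rcases h2 with ⟨x', y', b', h2, rfl⟩ | ⟨q', i', v', S', h2, rfl⟩
  · exact diamond_AA hL h1 h2
  · exact Or.inr (diamond_AB hL h1 h2)
  · obtain ⟨T0, g1, g2⟩ := diamond_AB hL h2 h1
    exact Or.inr ⟨T0, g2, g1⟩
  · by_cases hn : ∀ p, q = ap q' p → p = []
    · exact diamond_BB hL h1 h2 hn
    · have hn' : ∀ p, q' = ap q p → p = [] := by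
        rintro p rfl
        by_contra hp
        apply hn
        intro r hr
        rw [ap_ap, self_eq_ap] at hr
        simp at hr
        exact hr.2
      rcases diamond_BB hL h2 h1 hn' with g | ⟨T0, g1, g2⟩
      · exact Or.inl g.symm
      · exact Or.inr ⟨T0, g2, g1⟩

theorem Red.tsize_lt {T T1 : Bool → LT α} (h : Red T T1) : tsize T1 < tsize T := by
  rcases h with ⟨x, y, b, h, rfl⟩ | ⟨q, i, v, S, h, rfl⟩
  · obtain ⟨u, hu, hu'⟩ := h.root
    obtain ⟨w, hw, hw'⟩ := h.symm.root
    have e1 := tsize_st hu (.leaf b)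
    rw [← gt_st_disj T (.leaf b) h.disj'] at hw
    have e2 := tsize_st hw (.leaf b)
    have : 0 < u.size := by
      cases u with
      | leaf a => exact absurd rfl (hu' a)
      | node f => simp [LT.size]
    simp only [LT.size] at e1 e2
    omega
  · obtain ⟨u, hu, hS⟩ := h.root
    have e1 := tsize_st hu S
    have := LT.size_get_lt _ _ _ _ hS
    omega

end redex

/-! ### Labellings of couples -/

section labelling

variable {α : Type}

/-- `T` is a labelling of the couple `Q`: two leaves have the same label iff they are equal or
paired. -/
def Lab (T : Bool → LT α) (Q : Couple) : Prop :=
  (∀ c, (T c).shape = Q.treeOf c) ∧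
  ∀ x a, gt T x = some (.leaf a) → ∀ y, gt T y = some (.leaf a) ↔ y = x ∨ y = Q.pair x

/-- Sign of a node. -/
def sgn (x : NodeId) : Bool := posSign x.1 x.2

/-- `T` is a labelling of some couple. -/
def Valid (T : Bool → LT α) : Prop := ∀ x a, gt T x = some (.leaf a) →
  ∃ y, y ≠ x ∧ gt T y = some (.leaf a) ∧ sgn y = !(sgn x) ∧
    ∀ z, gt T z = some (.leaf a) → z = x ∨ z = y

theorem isLeaf_iff {T : Bool → LT α} {P N : TTree} (h : ∀ c, (T c).shape = cond c P N)
    (x : NodeId) : (cond x.1 P N).IsLeafPos x.2 ↔ ∃ a, gt T x = some (.leaf a) := by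
  rw [TTree.IsLeafPos, ← h x.1, LT.shape_get]
  simp only [Option.map_eq_some_iff, LT.shape_eq_leaf]
  constructor
  · rintro ⟨t, ht, a, rfl⟩; exact ⟨a, ht⟩
  · rintro ⟨a, ha⟩; exact ⟨_, ha, a, rfl⟩

theorem Lab.leaf_iff {T : Bool → LT α} {Q : Couple} (h : Lab T Q) (x : NodeId) :
    (cond x.1 Q.pos Q.neg).IsLeafPos x.2 ↔ ∃ a, gt T x = some (.leaf a) := isLeaf_iff h.1 x

theorem Lab.pair_gt {T : Bool → LT α} {Q : Couple} (h : Lab T Q) {x : NodeId} {a : α}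
    (hx : gt T x = some (.leaf a)) : gt T (Q.pair x) = some (.leaf a) :=
  (h.2 x a hx _).2 (Or.inr rfl)

theorem Lab.pair_eq {T : Bool → LT α} {Q : Couple} (h : Lab T Q) {x y : NodeId} {a : α}
    (hx : gt T x = some (.leaf a)) (hy : gt T y = some (.leaf a)) (hne : y ≠ x) :
    Q.pair x = y := by
  rcases (h.2 x a hx y).1 hy with g | g
  · exact absurd g hne
  · exact g.symm

theorem Lab.valid {T : Bool → LT α} {Q : Couple} (h : Lab T Q) : Valid T := by
  intro x a hx
  have hl := (h.leaf_iff x).2 ⟨a, hx⟩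
  exact ⟨Q.pair x, Q.pair_ne x hl, h.pair_gt hx, Q.pair_sign x hl, fun z hz => (h.2 x a hx z).1 hz⟩

theorem Valid.lin {T : Bool → LT α} (h : Valid T) : Lin T := by
  intro x y z a hx hy hz
  obtain ⟨w, -, -, -, hw⟩ := h x a hx
  have h1 := hw y hy
  have h2 := hw z hz
  grind

theorem Lab.unique {T : Bool → LT α} {Q Q' : Couple} (h : Lab T Q) (h' : Lab T Q') : Q = Q' := by
  have hp : Q.pos = Q'.pos := (h.1 true).symm.trans (h'.1 true)
  have hn : Q.neg = Q'.neg := (h.1 false).symm.trans (h'.1 false)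
  have hpair : Q.pair = Q'.pair := by
    funext x
    by_cases hx : ∃ a, gt T x = some (.leaf a)
    · obtain ⟨a, ha⟩ := hx
      refine h.pair_eq ha (h'.pair_gt ha) (Q'.pair_ne x ((h'.leaf_iff x).2 ⟨a, ha⟩))
    · rw [Q.pair_norm x (fun g => hx ((h.leaf_iff x).1 g)),
        Q'.pair_norm x (fun g => hx ((h'.leaf_iff x).1 g))]
  cases Q
  cases Q'
  simp only at hp hn hpair
  subst hp hn hpair
  rfl

open Classical in
theorem Valid.exists_lab {T : Bool → LT α} (h : Valid T) : ∃ Q, Lab T Q := by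
  choose! f hf using h
  let P := (T true).shape
  let N := (T false).shape
  let g : NodeId → NodeId := fun x =>
    if hx : ∃ a, gt T x = some (.leaf a) then f x hx.choose else x
  have hPN : ∀ c, (T c).shape = cond c P N := by intro c; cases c <;> rfl
  have hl := isLeaf_iff hPN
  have hg : ∀ x a, gt T x = some (.leaf a) → g x = f x a := by
    intro x a hx
    have hex : ∃ a, gt T x = some (.leaf a) := ⟨a, hx⟩
    have : hex.choose = a := by
      have := hx.symm.trans hex.choose_spec
      simpa using this.symm
    simp only [g, dif_pos hex, this]
  refine ⟨⟨P, N, g, ?_, ?_, ?_, ?_, ?_⟩, hPN, ?_⟩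
  · intro x hx
    obtain ⟨a, ha⟩ := (hl x).1 hx
    rw [hl, hg x a ha]
    exact ⟨a, (hf x a ha).2.1⟩
  · intro x hx
    obtain ⟨a, ha⟩ := (hl x).1 hx
    have h1 := hf x a ha
    have h2 := hf _ a h1.2.1
    rw [hg x a ha, hg _ a h1.2.1]
    rcases h1.2.2.2 _ h2.2.1 with e | e
    · exact e
    · exact absurd e h2.1
  · intro x hx
    obtain ⟨a, ha⟩ := (hl x).1 hx
    rw [hg x a ha]; exact (hf x a ha).1
  · intro x hx
    obtain ⟨a, ha⟩ := (hl x).1 hx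
    rw [hg x a ha]; exact (hf x a ha).2.2.1
  · intro x hx
    rw [hl] at hx
    simp only [g, dif_neg hx]
  · intro x a hx y
    change _ ↔ y = x ∨ y = g x
    rw [hg x a hx]
    constructor
    · exact (hf x a hx).2.2.2 y
    · rintro (rfl | rfl)
      · exact hx
      · exact (hf x a hx).2.1

/-- Every couple has a labelling. -/
theorem exists_labelling (Q : Couple) : ∃ T : Bool → LT (Sym2 NodeId), Lab T Q := by
  let T : Bool → LT (Sym2 NodeId) := fun c =>
    LT.ofFn (Q.treeOf c) (fun p => s(((c, p) : NodeId), Q.pair (c, p)))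
  have hs : ∀ c, (T c).shape = cond c Q.pos Q.neg := fun c => LT.shape_ofFn _ _
  have hl := isLeaf_iff hs
  have hlab : ∀ x a, gt T x = some (.leaf a) → a = s(x, Q.pair x) :=
    fun x a h => LT.get_ofFn _ _ _ _ h
  refine ⟨T, hs, ?_⟩
  intro x a hx y
  have hxl := (hl x).2 ⟨a, hx⟩
  have ha := hlab x a hx
  constructor
  · intro hy
    have ha' := hlab y a hy
    rw [ha, Sym2.eq_iff] at ha'
    rcases ha' with ⟨e, -⟩ | ⟨-, e⟩
    · exact Or.inl e.symm
    · exact Or.inr e.symm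
  · rintro (rfl | rfl)
    · exact hx
    · obtain ⟨b, hb⟩ := (hl _).1 (Q.pair_leaf x hxl)
      have := hlab _ _ hb
      rw [Q.pair_invol x hxl, Sym2.eq_swap, ← ha] at this
      rw [hb, this]

/-- Leaf correspondence induced by a reverse step. -/
structure Emb (T T1 : Bool → LT α) (φ : NodeId → NodeId) (e1 e2 e3 e4 : NodeId) : Prop where
  lab : ∀ y a, gt T1 y = some (.leaf a) → gt T (φ y) = some (.leaf a)
  inj : ∀ y z a b, gt T1 y = some (.leaf a) → gt T1 z = some (.leaf b) → φ y = φ z → y = z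
  surj : ∀ z a, gt T z = some (.leaf a) →
    (∃ y, φ y = z ∧ gt T1 y = some (.leaf a)) ∨ z = e1 ∨ z = e2 ∨ z = e3 ∨ z = e4
  avoid : ∀ y a, gt T1 y = some (.leaf a) → φ y ≠ e1 ∧ φ y ≠ e2 ∧ φ y ≠ e3 ∧ φ y ≠ e4
  ne12 : e1 ≠ e2
  ne34 : e3 ≠ e4
  lab12 : ∃ a, gt T e1 = some (.leaf a) ∧ gt T e2 = some (.leaf a)
  lab34 : ∃ a, gt T e3 = some (.leaf a) ∧ gt T e4 = some (.leaf a)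
  sign : ∀ y z a, gt T1 y = some (.leaf a) → gt T1 z = some (.leaf a) →
    sgn (φ z) = !(sgn (φ y)) → sgn z = !(sgn y)

/-- The raw pairing function `raw` is the one induced by `g` via the leaf correspondence. -/
structure RawOk (T1 : Bool → LT α) (φ raw g : NodeId → NodeId) (e1 e2 e3 e4 : NodeId) :
    Prop where
  comm : ∀ y a, gt T1 y = some (.leaf a) → raw (φ y) = φ (g y)
  r1 : raw e1 = e2
  r2 : raw e2 = e1
  r3 : raw e3 = e4
  r4 : raw e4 = e3

theorem Emb.valid {T T1 : Bool → LT α} {φ e1 e2 e3 e4} (h : Emb T T1 φ e1 e2 e3 e4)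
    (hT : Valid T) : Valid T1 := by
  intro y a hy
  obtain ⟨z, hz1, hz2, hz3, hz4⟩ := hT (φ y) a (h.lab y a hy)
  have hL := hT.lin
  obtain ⟨av1, av2, av3, av4⟩ := h.avoid y a hy
  have hya := h.lab y a hy
  rcases h.surj z a hz2 with ⟨w, rfl, hw⟩ | hz
  · refine ⟨w, ?_, hw, h.sign y w a hy hw hz3, ?_⟩
    · rintro rfl; exact hz1 rfl
    · intro u hu
      rcases hz4 _ (h.lab u a hu) with g | g
      · exact Or.inl (h.inj _ _ _ _ hu hy g)
      · exact Or.inr (h.inj _ _ _ _ hu hw g)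
  · exfalso
    obtain ⟨b, hb1, hb2⟩ := h.lab12
    obtain ⟨c, hc1, hc2⟩ := h.lab34
    have n12 := h.ne12
    have n34 := h.ne34
    rcases hz with rfl | rfl | rfl | rfl
    · rw [hz2] at hb1; cases hb1
      rcases hL _ _ _ _ hya hz2 hb2 with g | g | g <;> contradiction
    · rw [hz2] at hb2; cases hb2
      rcases hL _ _ _ _ hya hb1 hz2 with g | g | g <;> contradiction
    · rw [hz2] at hc1; cases hc1
      rcases hL _ _ _ _ hya hz2 hc2 with g | g | g <;> contradiction
    · rw [hz2] at hc2; cases hc2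
      rcases hL _ _ _ _ hya hc1 hz2 with g | g | g <;> contradiction

theorem Emb.pair_eq {T T1 : Bool → LT α} {φ raw e1 e2 e3 e4} {Q Q1 : Couple}
    (h : Emb T T1 φ e1 e2 e3 e4) (hr : RawOk T1 φ raw Q1.pair e1 e2 e3 e4)
    (hQ : Lab T Q) (hQ1 : Lab T1 Q1) : Q.pair = normalizePair Q.pos Q.neg raw := by
  funext x
  simp only [normalizePair]
  split
  · rename_i hx
    obtain ⟨a, ha⟩ := (hQ.leaf_iff x).1 hx
    obtain ⟨b, hb1, hb2⟩ := h.lab12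
    obtain ⟨c, hc1, hc2⟩ := h.lab34
    rcases h.surj x a ha with ⟨y, rfl, hy⟩ | rfl | rfl | rfl | rfl
    · rw [hr.comm y a hy]
      have hp := hQ1.pair_gt hy
      refine hQ.pair_eq ha (h.lab _ _ hp) ?_
      intro e
      exact Q1.pair_ne y ((hQ1.leaf_iff y).2 ⟨a, hy⟩) (h.inj _ _ _ _ hp hy e)
    · rw [hr.r1]; exact hQ.pair_eq hb1 hb2 h.ne12.symm
    · rw [hr.r2]; exact hQ.pair_eq hb2 hb1 h.ne12
    · rw [hr.r3]; exact hQ.pair_eq hc1 hc2 h.ne34.symm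
    · rw [hr.r4]; exact hQ.pair_eq hc2 hc1 h.ne34
  · rename_i hx
    exact Q.pair_norm x hx

theorem Emb.lab_of {T T1 : Bool → LT α} {φ raw e1 e2 e3 e4} {Q Q1 : Couple}
    (h : Emb T T1 φ e1 e2 e3 e4) (hr : RawOk T1 φ raw Q1.pair e1 e2 e3 e4)
    (hQ : Lab T Q) (hp : Q.pair = normalizePair Q.pos Q.neg raw)
    (hs : ∀ c, (T1 c).shape = Q1.treeOf c) : Lab T1 Q1 := by
  refine ⟨hs, ?_⟩
  intro x a hx y
  have hl := isLeaf_iff hs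
  have hφx := h.lab x a hx
  have hpx : Q.pair (φ x) = φ (Q1.pair x) := by
    rw [hp, normalizePair, if_pos ((hQ.leaf_iff _).2 ⟨a, hφx⟩), hr.comm x a hx]
  obtain ⟨b, hb⟩ := (hl _).1 (Q1.pair_leaf x ((hl x).2 ⟨a, hx⟩))
  have hb' := h.lab _ _ hb
  have hab := hQ.pair_gt hφx
  rw [hpx, hb'] at hab
  cases hab
  constructor
  · intro hy
    rcases (hQ.2 _ _ hφx _).1 (h.lab y _ hy) with e | e
    · exact Or.inl (h.inj _ _ _ _ hy hx e)
    · rw [hpx] at e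
      exact Or.inr (h.inj _ _ _ _ hy hb e)
  · rintro (rfl | rfl)
    · exact hx
    · exact hb

end labelling

/-! ### Comparing steps of couples with reverse steps of labelled trees -/

section compare

variable {α : Type}

theorem posSign_append (b : Bool) (p r : Pos) :
    posSign b (p ++ r) = posSign (posSign b p) r := by
  simp only [posSign, List.count_append]
  rcases Nat.mod_two_eq_zero_or_one (p.count 1) with h1 | h1 <;>
  rcases Nat.mod_two_eq_zero_or_one (r.count 1) with h2 | h2 <;>
  cases b <;> simp [Nat.add_mod, h1, h2]

theorem sgn_ap (x : NodeId) (p : Pos) : sgn (ap x p) = posSign (sgn x) p := posSign_append _ _ _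

theorem sgn_bmp (q : NodeId) (i : Fin 3) (v : Bool) (y : NodeId) :
    sgn (bmp q i (loneIdx i v) y) = sgn y := by
  by_cases h : Below q y
  · obtain ⟨p, rfl⟩ := h
    rw [bmp_ap]
    have e : ap q (i :: loneIdx i v :: p) = ap (ap q [i, loneIdx i v]) p := by simp [ap_ap]
    rw [e, sgn_ap, sgn_ap, sgn_ap]
    congr 1
    generalize sgn q = s
    clear e
    revert i v s; decide
  · rw [bmp_not _ _ _ _ h]

theorem RedB.ok_leaf {T : Bool → LT α} {q i v S} (h : RedB T q i v S) {y : NodeId} {a : α}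
    (hy : gt (WKE.st T q S) y = some (.leaf a)) : Ok q y := by
  by_cases hq : Below q y
  · exact Or.inl hq
  · refine Or.inr ⟨hq, ?_⟩
    rintro ⟨p, rfl⟩
    obtain ⟨u, hu, -⟩ := h.root
    have := leaf_below hy (gt_st_same hu S)
    subst this
    exact hq ⟨[], by simp⟩

theorem bmp_avoid (q : NodeId) (i : Fin 3) (v : Bool) {y : NodeId} (hy : Ok q y) :
    bmp q i (loneIdx i v) y ≠ ap q (bPairs i v).1.1 ∧
    bmp q i (loneIdx i v) y ≠ ap q (bPairs i v).1.2 ∧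
    bmp q i (loneIdx i v) y ≠ ap q (bPairs i v).2.1 ∧
    bmp q i (loneIdx i v) y ≠ ap q (bPairs i v).2.2 := by
  rcases hy with ⟨p, rfl⟩ | hy
  · obtain ⟨j1, j2, k1, k2, hb, g1, g2, g3, g4, g5, g6, g7, g8⟩ := bp i v
    rw [hb, bmp_ap]
    simp [g4.symm, g5.symm]
  · rw [bmp_not _ _ _ _ hy.1]
    refine ⟨?_, ?_, ?_, ?_⟩ <;> rintro rfl <;> exact hy.1 ⟨_, rfl⟩

theorem RedB.emb {T : Bool → LT α} {q i v S} (h : RedB T q i v S) :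
    Emb T (st T q S) (bmp q i (loneIdx i v)) (ap q (bPairs i v).1.1) (ap q (bPairs i v).1.2)
      (ap q (bPairs i v).2.1) (ap q (bPairs i v).2.2) where
  lab := fun y a hy => by rw [← h.gt_bmp (h.ok_leaf hy)]; exact hy
  inj := fun y z a b _ _ => bmp_inj _ _ _ _ _
  surj := by
    intro z a hz
    have hbr := h.branch
    obtain ⟨u, hu, -⟩ := h.root
    have hn : ∀ p, q = ap z p → p = [] := by
      rintro p rfl
      exact leaf_below hz hu
    rcases h.classify hz hn with rfl | rfl | h1 | h1 | h1 | h1 | ⟨y, hy, rfl⟩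
    · exact absurd hz (hbr.1 a)
    · exact absurd hz (hbr.2 a)
    · right; left; exact h1
    · right; right; left; exact h1
    · right; right; right; left; exact h1
    · right; right; right; right; exact h1
    · exact Or.inl ⟨y, rfl, by rw [h.gt_bmp hy]; exact hz⟩
  avoid := fun y a hy => bmp_avoid q i v (h.ok_leaf hy)
  ne12 := by
    obtain ⟨j1, j2, k1, k2, hb, -⟩ := bp i v
    rw [hb]; simp
  ne34 := by
    obtain ⟨j1, j2, k1, k2, hb, -⟩ := bp i v
    rw [hb]; simp
  lab12 := by
    obtain ⟨a, b, h1, h2, h3, h4, h5⟩ := h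
    exact ⟨a, h1, h2⟩
  lab34 := by
    obtain ⟨a, b, h1, h2, h3, h4, h5⟩ := h
    exact ⟨b, h3, h4⟩
  sign := fun y z a _ _ hs => by rwa [sgn_bmp, sgn_bmp] at hs

theorem stepB_unfold (f : NodeId → NodeId) (q : NodeId) (i : Fin 3) (v : Bool) (x : NodeId) :
    stepBPairRaw f q.1 q.2 i v x =
      if x = ap q (bPairs i v).1.1 then ap q (bPairs i v).1.2
      else if x = ap q (bPairs i v).1.2 then ap q (bPairs i v).1.1
      else if x = ap q (bPairs i v).2.1 then ap q (bPairs i v).2.2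
      else if x = ap q (bPairs i v).2.2 then ap q (bPairs i v).2.1
      else if x.1 = q.1 ∧ (q.2 ++ [i, loneIdx i v]) <+: x.2 then
        bmp q i (loneIdx i v) (f (ap q (x.2.drop (q.2.length + 2))))
      else bmp q i (loneIdx i v) (f x) := rfl

theorem RedB.raw {T : Bool → LT α} {q i v S} (h : RedB T q i v S) (g : NodeId → NodeId) :
    RawOk (st T q S) (bmp q i (loneIdx i v)) (stepBPairRaw g q.1 q.2 i v) g
      (ap q (bPairs i v).1.1) (ap q (bPairs i v).1.2)
      (ap q (bPairs i v).2.1) (ap q (bPairs i v).2.2) where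
  comm := by
    intro y a hy
    have hok := h.ok_leaf hy
    obtain ⟨a1, a2, a3, a4⟩ := bmp_avoid q i v hok
    rw [stepB_unfold, if_neg a1, if_neg a2, if_neg a3, if_neg a4]
    rcases hok with ⟨p, rfl⟩ | hok
    · rw [bmp_ap, if_pos]
      · simp [ap]
      · simp [ap]
    · rw [bmp_not _ _ _ _ hok.1, if_neg]
      rintro ⟨h1, r, hr⟩
      apply hok.1
      rw [below_iff]
      exact ⟨h1, [i, loneIdx i v] ++ r, by simpa using hr⟩
  r1 := by rw [stepB_unfold, if_pos rfl]
  r2 := by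
    obtain ⟨j1, j2, k1, k2, hb, g1, g2, g3, g4, g5, g6, g7, g8⟩ := bp i v
    rw [stepB_unfold, hb]; simp
  r3 := by
    obtain ⟨j1, j2, k1, k2, hb, g1, g2, g3, g4, g5, g6, g7, g8⟩ := bp i v
    rw [stepB_unfold, hb]; simp [g3.symm]
  r4 := by
    obtain ⟨j1, j2, k1, k2, hb, g1, g2, g3, g4, g5, g6, g7, g8⟩ := bp i v
    rw [stepB_unfold, hb]; simp [g6.symm]

theorem RedB.shape {T : Bool → LT α} {q i v S} (h : RedB T q i v S) {u : LT α}
    (hu : gt T q = some u) : u.shape = miniT i (loneIdx i v) S.shape := by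
  obtain ⟨a, b, h1, h2, h3, h4, h5⟩ := h
  rw [gt_ap_some hu] at h1 h2 h3 h4 h5
  clear hu
  cases u with
  | leaf c => simp at h5
  | node f =>
    cases hf : f i with
    | leaf c => simp [hf] at h5
    | node g =>
      fin_cases i <;> cases v <;>
        simp_all [bPairs, loneIdx, LT.shape, miniT, gchildT]

theorem replace_of_lab {T T1 : Bool → LT α} {Q : Couple}
    (hQ : ∀ c, (T c).shape = Q.treeOf c) (hs : SameShape T T1) : ∀ c, (T1 c).shape = Q.treeOf c :=
  fun c => (hs c).symm.trans (hQ c)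

theorem stepB_of_red {T : Bool → LT α} {q i v S} {Q Q1 : Couple} (h : RedB T q i v S)
    (hQ : Lab T Q) (hQ1 : Lab (st T q S) Q1) : StepBAt Q1 Q q.1 q.2 i v := by
  obtain ⟨u, hu, -⟩ := h.root
  have hT : st (st T q S) q u = T := by rw [st_st_same, st_get hu]
  refine ⟨S.shape, ?_, ?_, ?_, h.emb.pair_eq (h.raw _) hQ hQ1⟩
  · rw [← hQ1.1, LT.shape_get]
    have := gt_st_same hu S
    rw [gt] at this
    rw [this]; rfl
  · rw [← hQ1.1, ← hQ.1, ← h.shape hu]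
    conv_lhs => rw [← hT]
    rw [st, Function.update_self, LT.shape_set]
  · rw [← hQ1.1, ← hQ.1, st]
    simp

/-- A labelled mini tree. -/
def miniL (d : α) (i k : Fin 3) (S : LT α) : LT α :=
  .node (fun j => if j = i then .node (fun m => if m = k then S else .leaf d) else .leaf d)

theorem shape_miniL (d : α) (i k : Fin 3) (S : LT α) :
    (miniL d i k S).shape = miniT i k S.shape := by
  fin_cases i <;> fin_cases k <;> simp [miniL, LT.shape, miniT, gchildT]

theorem red_of_stepB (d : α) {T : Bool → LT α} {Q Q1 : Couple} {q : NodeId} {i v}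
    (hQ : Lab T Q) (hst : StepBAt Q1 Q q.1 q.2 i v) :
    ∃ S, RedB T q i v S ∧ Lab (st T q S) Q1 := by
  obtain ⟨S0, s1, s2, s3, s4⟩ := hst
  let T1 : Bool → LT α := fun c => LT.ofFn (Q1.treeOf c) (fun _ => d)
  have hT1 : ∀ c, (T1 c).shape = Q1.treeOf c := fun c => LT.shape_ofFn _ _
  obtain ⟨S1, hS1, hS1'⟩ : ∃ S1, gt T1 q = some S1 ∧ S1.shape = S0 := by
    rw [← hT1, LT.shape_get] at s1
    simpa [gt] using s1
  have hss : SameShape T (st T1 q (miniL d i (loneIdx i v) S1)) := by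
    intro c
    rw [hQ.1]
    by_cases hc : c = q.1
    · subst hc
      rw [s2, st, Function.update_self, LT.shape_set, shape_miniL, hS1', hT1]
    · have : c = !q.1 := by
        revert hc; cases c <;> cases q.1 <;> simp
      rw [this, s3, st, Function.update_of_ne (by simp), hT1]
  have hget : ∀ p, gt (st T1 q (miniL d i (loneIdx i v) S1)) (ap q p) =
      (miniL d i (loneIdx i v) S1).get p := fun p => gt_st_ap hS1 _ p
  obtain ⟨j1, j2, k1, k2, hb, g1, g2, g3, g4, g5, g6, g7, g8⟩ := bp i v
  obtain ⟨a1, l1⟩ : ∃ a, gt T (ap q (bPairs i v).1.1) = some (.leaf a) := by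
    apply hss.leaf (a := d); rw [hget, hb]; simp [miniL, g1]
  obtain ⟨a2, l2⟩ : ∃ a, gt T (ap q (bPairs i v).1.2) = some (.leaf a) := by
    apply hss.leaf (a := d); rw [hget, hb]; simp [miniL, g4]
  obtain ⟨a3, l3⟩ : ∃ a, gt T (ap q (bPairs i v).2.1) = some (.leaf a) := by
    apply hss.leaf (a := d); rw [hget, hb]; simp [miniL, g2]
  obtain ⟨a4, l4⟩ : ∃ a, gt T (ap q (bPairs i v).2.2) = some (.leaf a) := by
    apply hss.leaf (a := d); rw [hget, hb]; simp [miniL, g5]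
  obtain ⟨S, l5, hS⟩ : ∃ S, gt T (ap q [i, loneIdx i v]) = some S ∧ S.shape = S1.shape := by
    apply hss.gt; rw [hget]; simp [miniL]
  have p12 : Q.pair (ap q (bPairs i v).1.1) = ap q (bPairs i v).1.2 := by
    rw [s4, normalizePair, if_pos ((hQ.leaf_iff _).2 ⟨_, l1⟩), stepB_unfold, if_pos rfl]
  have p34 : Q.pair (ap q (bPairs i v).2.1) = ap q (bPairs i v).2.2 := by
    rw [s4, normalizePair, if_pos ((hQ.leaf_iff _).2 ⟨_, l3⟩), stepB_unfold, hb]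
    simp [g3.symm]
  have q12 := hQ.pair_gt l1
  rw [p12, l2] at q12
  cases q12
  have q34 := hQ.pair_gt l3
  rw [p34, l4] at q34
  cases q34
  have hred : RedB T q i v S := ⟨a1, a3, l1, l2, l3, l4, l5⟩
  refine ⟨S, hred, hred.emb.lab_of (hred.raw _) hQ s4 ?_⟩
  intro c
  rw [hss.st q hS c, st_st_same, st_get hS1, hT1]

/-! Step A. -/

open Classical in
/-- Leaf correspondence for step A. -/
noncomputable def phiA (x y z : NodeId) : NodeId :=
  if z = x then ap x [1] else if z = y then ap y [1] else z

theorem RedA.leaf_cases {T : Bool → LT α} {x y b} (h : RedA T x y b) {z : NodeId} {a : α}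
    (hz : gt (WKE.st (WKE.st T x (.leaf b)) y (.leaf b)) z = some (.leaf a)) :
    (z = x ∧ a = b) ∨ (z = y ∧ a = b) ∨
      (Disj x z ∧ Disj y z ∧ gt T z = some (.leaf a)) := by
  obtain ⟨u, hu, -⟩ := h.root
  obtain ⟨w, hw, -⟩ := h.symm.root
  have hd := h.disj'
  have gy : gt (WKE.st (WKE.st T x (.leaf b)) y (.leaf b)) y = some (.leaf b) := by
    rw [← gt_st_disj T (.leaf b) hd] at hw
    exact gt_st_same hw _
  have gx : gt (WKE.st (WKE.st T x (.leaf b)) y (.leaf b)) x = some (.leaf b) := by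
    rw [st_comm _ _ _ hd]
    rw [← gt_st_disj T (.leaf b) hd.symm] at hu
    exact gt_st_same hu _
  by_cases h1 : z = x
  · subst h1
    rw [gx] at hz
    cases hz; simp
  by_cases h2 : z = y
  · subst h2
    rw [gy] at hz
    cases hz; simp
  right; right
  have d1 : Disj x z := by
    constructor
    · rintro ⟨p, rfl⟩
      have := leaf_below gx hz
      subst this; simp at h1
    · rintro ⟨p, hp⟩
      have := leaf_below (p := p) (u := .leaf b) hz (by rw [← hp]; exact gx)
      subst this; simp at hp; exact h1 hp.symm
  have d2 : Disj y z := by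
    constructor
    · rintro ⟨p, rfl⟩
      have := leaf_below gy hz
      subst this; simp at h2
    · rintro ⟨p, hp⟩
      have := leaf_below (p := p) (u := .leaf b) hz (by rw [← hp]; exact gy)
      subst this; simp at hp; exact h2 hp.symm
  refine ⟨d1, d2, ?_⟩
  rwa [gt_st_disj _ _ d2, gt_st_disj _ _ d1] at hz

theorem RedA.gx {T : Bool → LT α} {x y b} (h : RedA T x y b) :
    gt (WKE.st (WKE.st T x (.leaf b)) y (.leaf b)) x = some (.leaf b) := by
  obtain ⟨u, hu, -⟩ := h.root
  have hd := h.disj'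
  rw [st_comm _ _ _ hd]
  rw [← gt_st_disj T (.leaf b) hd.symm] at hu
  exact gt_st_same hu _

theorem RedA.gy {T : Bool → LT α} {x y b} (h : RedA T x y b) :
    gt (WKE.st (WKE.st T x (.leaf b)) y (.leaf b)) y = some (.leaf b) := by
  rw [st_comm _ _ _ h.disj']
  exact h.symm.gx

theorem phiA_x (x y : NodeId) : phiA x y x = ap x [1] := by simp [phiA]
theorem phiA_y (x y : NodeId) (h : x ≠ y) : phiA x y y = ap y [1] := by simp [phiA, h.symm]
theorem phiA_z (x y z : NodeId) (h1 : Disj x z) (h2 : Disj y z) : phiA x y z = z := by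
  have e1 : z ≠ x := by rintro rfl; exact h1.1 ⟨[], by simp⟩
  have e2 : z ≠ y := by rintro rfl; exact h2.1 ⟨[], by simp⟩
  simp [phiA, e1, e2]

theorem Disj.ne_ap {x z : NodeId} (h : Disj x z) (p : Pos) : z ≠ WKE.ap x p :=
  fun e => h.1 ⟨p, e⟩

theorem RedA.emb {T : Bool → LT α} (hL : Lin T) {x y : NodeId} {σ : Fin 3 → Fin 3}
    {l : Fin 3 → α} (hne : x ≠ y) (hσ : σ = id ∨ σ = swap02)
    (hl : ∀ j, gt T (ap x [j]) = some (.leaf (l j)) ∧ gt T (ap y [σ j]) = some (.leaf (l j))) :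
    Emb T (st (st T x (.leaf (l 1))) y (.leaf (l 1))) (phiA x y) (ap x [0]) (ap y [σ 0])
      (ap x [2]) (ap y [σ 2]) := by
  have h : RedA T x y (l 1) := ⟨hne, σ, l, hσ, rfl, hl⟩
  have hσ1 : σ 1 = 1 := by rcases hσ with rfl | rfl <;> rfl
  have hσ0 : σ 0 ≠ 1 := by rcases hσ with rfl | rfl <;> decide
  have hσ2 : σ 2 ≠ 1 := by rcases hσ with rfl | rfl <;> decide
  have hlab : ∀ z a, gt (st (st T x (.leaf (l 1))) y (.leaf (l 1))) z = some (.leaf a) →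
      gt T (phiA x y z) = some (.leaf a) := by
    intro z a hz
    rcases h.leaf_cases hz with ⟨rfl, rfl⟩ | ⟨rfl, rfl⟩ | ⟨d1, d2, h3⟩
    · rw [phiA_x]; exact h.mid.1
    · rw [phiA_y _ _ hne]; exact h.mid.2
    · rw [phiA_z _ _ _ d1 d2]; exact h3
  have hinj : ∀ z w a b, gt (st (st T x (.leaf (l 1))) y (.leaf (l 1))) z = some (.leaf a) →
      gt (st (st T x (.leaf (l 1))) y (.leaf (l 1))) w = some (.leaf b) →
      phiA x y z = phiA x y w → z = w := by
    intro z w a b hz hw he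
    rcases h.leaf_cases hz with ⟨rfl, rfl⟩ | ⟨rfl, rfl⟩ | ⟨d1, d2, h3⟩ <;>
    rcases h.leaf_cases hw with ⟨rfl, rfl⟩ | ⟨rfl, rfl⟩ | ⟨d1', d2', h3'⟩
    · rfl
    · rw [phiA_x, phiA_y _ _ hne, ap_single] at he; exact he.1
    · rw [phiA_x, phiA_z _ _ _ d1' d2'] at he; exact absurd he.symm (d1'.ne_ap _)
    · rw [phiA_x, phiA_y _ _ hne, ap_single] at he; exact he.1
    · rfl
    · rw [phiA_y _ _ hne, phiA_z _ _ _ d1' d2'] at he; exact absurd he.symm (d2'.ne_ap _)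
    · rw [phiA_x, phiA_z _ _ _ d1 d2] at he; exact absurd he (d1.ne_ap _)
    · rw [phiA_y _ _ hne, phiA_z _ _ _ d1 d2] at he; exact absurd he (d2.ne_ap _)
    · rwa [phiA_z _ _ _ d1 d2, phiA_z _ _ _ d1' d2'] at he
  refine ⟨hlab, hinj, ?_, ?_, ?_, ?_, ⟨l 0, hl 0⟩, ⟨l 2, hl 2⟩, ?_⟩
  · intro z a hz
    by_cases b1 : Below x z
    · obtain ⟨p, rfl⟩ := b1
      rcases h.below hz with rfl | ⟨j, a', rfl, -⟩
      · obtain ⟨u, hu, hu'⟩ := h.root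
        rw [ap_nil, hu] at hz
        cases hz; exact absurd rfl (hu' _)
      · fin_cases j
        · right; left; rfl
        · left
          have := (hl 1).1
          simp only [Fin.mk_one, Fin.isValue] at hz
          rw [hz] at this
          cases this
          exact ⟨x, phiA_x _ _, h.gx⟩
        · right; right; right; left; rfl
    by_cases b2 : Below y z
    · obtain ⟨p, rfl⟩ := b2
      rcases h.symm.below hz with rfl | ⟨j, a', rfl, -⟩
      · obtain ⟨u, hu, hu'⟩ := h.symm.root
        rw [ap_nil, hu] at hz
        cases hz; exact absurd rfl (hu' _)
      · have : j = σ 0 ∨ j = 1 ∨ j = σ 2 := by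
          rcases hσ with rfl | rfl
          · clear * -
            revert j; decide
          · clear * -
            revert j; decide
        rcases this with rfl | rfl | rfl
        · right; right; left; rfl
        · left
          have := h.mid.2
          rw [hz] at this
          cases this
          exact ⟨y, phiA_y _ _ hne, h.gy⟩
        · right; right; right; right; rfl
    · left
      obtain ⟨u, hu, hu'⟩ := h.root
      obtain ⟨w, hw, hw'⟩ := h.symm.root
      have d1 : Disj x z := by
        refine ⟨b1, ?_⟩
        rintro ⟨p, rfl⟩
        have := leaf_below hz hu
        subst this
        exact b1 ⟨[], by simp⟩
      have d2 : Disj y z := by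
        refine ⟨b2, ?_⟩
        rintro ⟨p, rfl⟩
        have := leaf_below hz hw
        subst this
        exact b2 ⟨[], by simp⟩
      refine ⟨z, phiA_z _ _ _ d1 d2, ?_⟩
      rwa [gt_st_disj _ _ d2, gt_st_disj _ _ d1]
  · intro z a hz
    rcases h.leaf_cases hz with ⟨rfl, rfl⟩ | ⟨rfl, rfl⟩ | ⟨d1, d2, h3⟩
    · rw [phiA_x]
      simp [ap_single, hne]
    · rw [phiA_y _ _ hne]
      simp [ap_single, hne.symm, hσ0.symm, hσ2.symm]
    · rw [phiA_z _ _ _ d1 d2]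
      exact ⟨d1.ne_ap _, d2.ne_ap _, d1.ne_ap _, d2.ne_ap _⟩
  · simp [ap_single, hne]
  · simp [ap_single, hne]
  · intro z w a hz hw hs
    have key : ∀ w, gt (st (st T x (.leaf (l 1))) y (.leaf (l 1))) w = some (.leaf (l 1)) →
        w = x ∨ w = y := by
      intro w hw
      rcases hL _ _ _ _ (hlab x _ h.gx) (hlab y _ h.gy) (hlab w _ hw) with g | g | g
      · exact absurd (hinj _ _ _ _ h.gx h.gy g) hne
      · exact Or.inl (hinj _ _ _ _ h.gx hw g).symm
      · exact Or.inr (hinj _ _ _ _ h.gy hw g).symm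
    have flip : ∀ w, w = x ∨ w = y → sgn (phiA x y w) = !(sgn w) := by
      rintro w (rfl | rfl)
      · rw [phiA_x, sgn_ap]; cases sgn w <;> decide
      · rw [phiA_y _ _ hne, sgn_ap]; cases sgn w <;> decide
    have main : a = l 1 → sgn w = !(sgn z) := by
      rintro rfl
      rw [flip _ (key z hz), flip _ (key w hw)] at hs
      revert hs; cases sgn w <;> cases sgn z <;> simp
    rcases h.leaf_cases hz with ⟨-, e⟩ | ⟨-, e⟩ | ⟨d1, d2, h3⟩
    · exact main e
    · exact main e
    rcases h.leaf_cases hw with ⟨-, e⟩ | ⟨-, e⟩ | ⟨d1', d2', h3'⟩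
    · exact main e
    · exact main e
    rwa [phiA_z _ _ _ d1 d2, phiA_z _ _ _ d1' d2'] at hs

theorem stepA_unfold (f : NodeId → NodeId) (x y : NodeId) (σ : Fin 3 → Fin 3) (z : NodeId) :
    stepAPairRaw f x y σ z =
      if z = ap x [0] then ap y [σ 0]
      else if z = ap x [1] then ap y [σ 1]
      else if z = ap x [2] then ap y [σ 2]
      else if z = ap y [σ 0] then ap x [0]
      else if z = ap y [σ 1] then ap x [1]
      else if z = ap y [σ 2] then ap x [2]
      else f z := rfl

theorem stepA_values (f : NodeId → NodeId) {x y : NodeId} {σ : Fin 3 → Fin 3} (hne : x ≠ y)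
    (hσ : σ = id ∨ σ = swap02) (j : Fin 3) :
    stepAPairRaw f x y σ (ap x [j]) = ap y [σ j] ∧
    stepAPairRaw f x y σ (ap y [σ j]) = ap x [j] := by
  rw [stepA_unfold, stepA_unfold]
  simp only [ap_single, hne, hne.symm, false_and, if_false, true_and]
  rcases hσ with rfl | rfl <;> fin_cases j <;> simp [swap02]

theorem RedA.raw {T : Bool → LT α} {x y : NodeId} {σ : Fin 3 → Fin 3}
    {b : α} (h : RedA T x y b) (hσ : σ = id ∨ σ = swap02) {g : NodeId → NodeId}
    (hx : g x = y) (hg : ∀ z a, gt (st (st T x (.leaf b)) y (.leaf b)) z = some (.leaf a) →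
      g (g z) = z) :
    RawOk (st (st T x (.leaf b)) y (.leaf b)) (phiA x y) (stepAPairRaw g x y σ) g
      (ap x [0]) (ap y [σ 0]) (ap x [2]) (ap y [σ 2]) := by
  have hne := h.1
  have hσ1 : σ 1 = 1 := by rcases hσ with rfl | rfl <;> rfl
  have hy : g y = x := by rw [← hx]; exact hg _ _ h.gx
  refine ⟨?_, (stepA_values g hne hσ 0).1, (stepA_values g hne hσ 0).2,
    (stepA_values g hne hσ 2).1, (stepA_values g hne hσ 2).2⟩
  intro z a hz
  have v1 := stepA_values g hne hσ 1
  rw [hσ1] at v1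
  rcases h.leaf_cases hz with ⟨rfl, rfl⟩ | ⟨rfl, rfl⟩ | ⟨d1, d2, h3⟩
  · rw [phiA_x, hx, phiA_y _ _ hne, v1.1]
  · rw [phiA_y _ _ hne, hy, phiA_x, v1.2]
  · rw [phiA_z _ _ _ d1 d2, stepA_unfold]
    have n1 : z ≠ x := by simpa using d1.ne_ap []
    have n2 : z ≠ y := by simpa using d2.ne_ap []
    have m1 : g z ≠ x := by
      intro e
      apply n2
      rw [← hg z a hz, e, hx]
    have m2 : g z ≠ y := by
      intro e
      apply n1
      rw [← hg z a hz, e, hy]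
    simp [d1.ne_ap, d2.ne_ap, phiA, m1, m2]

theorem shape_graft (T1 : Bool → LT α) (x y : NodeId) (u w : LT α) (hu : u.shape = oneTree)
    (hw : w.shape = oneTree) (c : Bool) :
    (st (st T1 x u) y w c).shape = graft2 (T1 c).shape c x y oneTree := by
  obtain ⟨b, p⟩ := x
  obtain ⟨b', p'⟩ := y
  by_cases h1 : b = c <;> by_cases h2 : b' = c
  · subst h1 h2
    simp [st, graft2, LT.shape_set, hu, hw]
  · subst h1
    simp [st, graft2, LT.shape_set, hu, h2, Function.update_of_ne (Ne.symm h2)]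
  · subst h2
    simp [st, graft2, LT.shape_set, hw, h1, Function.update_of_ne (Ne.symm h1)]
  · simp [st, graft2, h1, h2, Function.update_of_ne (Ne.symm h1),
      Function.update_of_ne (Ne.symm h2)]

theorem RedA.shape {T : Bool → LT α} {x y b} (h : RedA T x y b) {u : LT α}
    (hu : gt T x = some u) : u.shape = oneTree := by
  have hc : ∀ j, ∃ a, u.get [j] = some (.leaf a) := by
    intro j
    obtain ⟨a, k, h1, -⟩ := h.child j
    rw [gt_ap_some hu] at h1
    exact ⟨a, h1⟩
  cases u with
  | leaf a =>
    obtain ⟨a, ha⟩ := hc 0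
    simp at ha
  | node f =>
    obtain ⟨a, ha⟩ := hc 0
    obtain ⟨b, hb⟩ := hc 1
    obtain ⟨c, hc⟩ := hc 2
    simp at ha hb hc
    simp [LT.shape, ha, hb, hc, oneTree]

theorem stepA_of_red {T : Bool → LT α} {x y b} {Q Q1 : Couple} (h : RedA T x y b)
    (hQ : Lab T Q) (hQ1 : Lab (st (st T x (.leaf b)) y (.leaf b)) Q1) : StepA Q1 Q := by
  obtain ⟨u, hu, -⟩ := h.root
  obtain ⟨w, hw, -⟩ := h.symm.root
  have hd := h.disj'
  have hT : st (st (st (st T x (.leaf b)) y (.leaf b)) x u) y w = T := by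
    rw [st_comm T _ _ hd, st_st_same, st_comm _ _ _ hd.symm, st_st_same]
    rw [st_get hu, st_get hw]
  have hxy : Q1.pair x = y := hQ1.pair_eq h.gx h.gy h.1.symm
  have hsh : ∀ c, Q.treeOf c = graft2 (Q1.treeOf c) c x y oneTree := by
    intro c
    rw [← hQ.1, ← hQ1.1, ← shape_graft _ x y u w (h.shape hu) (h.symm.shape hw), hT]
  obtain ⟨hne, σ, l, hσ, rfl, hl⟩ := id h
  refine ⟨x, σ, ?_, hσ, ?_, ?_, ?_⟩
  · exact (hQ1.leaf_iff x).2 ⟨_, h.gx⟩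
  · rw [hxy]; exact hsh true
  · rw [hxy]; exact hsh false
  · rw [hxy]
    refine (RedA.emb hQ.valid.lin hne hσ hl).pair_eq (h.raw hσ hxy ?_) hQ hQ1
    intro z a hz
    exact Q1.pair_invol z ((hQ1.leaf_iff z).2 ⟨a, hz⟩)

theorem red_of_stepA (d : α) {T : Bool → LT α} {Q Q1 : Couple}
    (hQ : Lab T Q) (hst : StepA Q1 Q) :
    ∃ x y b, RedA T x y b ∧ Lab (st (st T x (.leaf b)) y (.leaf b)) Q1 := by
  obtain ⟨x, σ, hx, hσ, s1, s2, s3⟩ := hst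
  let T1 : Bool → LT α := fun c => LT.ofFn (Q1.treeOf c) (fun _ => d)
  have hT1 : ∀ c, (T1 c).shape = Q1.treeOf c := fun c => LT.shape_ofFn _ _
  have hl1 := isLeaf_iff hT1
  have hxl : (cond x.1 Q1.pos Q1.neg).IsLeafPos x.2 := hx
  have hne : Q1.pair x ≠ x := Q1.pair_ne x hxl
  have hyl := Q1.pair_leaf x hxl
  generalize hy : Q1.pair x = y at *
  obtain ⟨a, ha⟩ := (hl1 x).1 hxl
  obtain ⟨b, hb⟩ := (hl1 y).1 hyl
  have hd : Disj x y := by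
    constructor
    · rintro ⟨p, rfl⟩
      have := leaf_below ha hb
      subst this; simp at hne
    · rintro ⟨p, rfl⟩
      have := leaf_below hb ha
      subst this; simp at hne
  let o : LT α := .node (fun _ => .leaf d)
  have ho : o.shape = oneTree := rfl
  have hss : SameShape T (st (st T1 x o) y o) := by
    intro c
    rw [hQ.1, shape_graft _ _ _ _ _ ho ho, hT1]
    cases c
    · exact s2
    · exact s1
  have hgy : ∀ j, gt (st (st T1 x o) y o) (ap y [j]) = some (.leaf d) := by
    intro j
    rw [← gt_st_disj T1 o hd] at hb
    rw [gt_st_ap hb]; rfl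
  have hgx : ∀ j, gt (st (st T1 x o) y o) (ap x [j]) = some (.leaf d) := by
    intro j
    rw [st_comm _ _ _ hd]
    rw [← gt_st_disj T1 o hd.symm] at ha
    rw [gt_st_ap ha]; rfl
  choose l hl using fun j => hss.leaf (hgx j)
  have hl2 : ∀ j, gt T (ap x [j]) = some (.leaf (l j)) ∧
      gt T (ap y [σ j]) = some (.leaf (l j)) := by
    intro j
    refine ⟨hl j, ?_⟩
    have := hQ.pair_gt (hl j)
    rwa [s3, normalizePair, if_pos ((hQ.leaf_iff _).2 ⟨_, hl j⟩),
      (stepA_values _ hne.symm hσ j).1] at this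
  have hred : RedA T x y (l 1) := ⟨hne.symm, σ, l, hσ, rfl, hl2⟩
  have hs' : ∀ c, (st (st T x (.leaf (l 1))) y (.leaf (l 1)) c).shape = Q1.treeOf c := by
    intro c
    have e := (hss.st x (s := .leaf (l 1)) (s' := .leaf a) rfl).st y
      (s := .leaf (l 1)) (s' := .leaf b) rfl c
    rw [e, st_comm T1 _ _ hd, st_st_same, st_comm _ _ _ hd.symm, st_st_same, st_get ha,
      st_get hb, hT1]
  refine ⟨x, y, l 1, hred,
    (RedA.emb hQ.valid.lin hne.symm hσ hl2).lab_of (hred.raw hσ hy ?_) hQ s3 hs'⟩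
  intro z a hz
  exact Q1.pair_invol z ((isLeaf_iff hs' z).2 ⟨a, hz⟩)

theorem red_of_step (d : α) {T : Bool → LT α} {Q Q1 : Couple} (hQ : Lab T Q) (h : Step Q1 Q) :
    ∃ T1, Red T T1 ∧ Lab T1 Q1 := by
  rcases h with h | ⟨c, q, i, v, h⟩
  · obtain ⟨x, y, b, h1, h2⟩ := red_of_stepA d hQ h
    exact ⟨_, Or.inl ⟨x, y, b, h1, rfl⟩, h2⟩
  · obtain ⟨S, h1, h2⟩ := red_of_stepB d (q := (c, q)) hQ h
    exact ⟨_, Or.inr ⟨_, i, v, S, h1, rfl⟩, h2⟩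

theorem step_of_red {T T1 : Bool → LT α} {Q : Couple} (hQ : Lab T Q) (h : Red T T1) :
    ∃ Q1, Lab T1 Q1 ∧ Step Q1 Q := by
  rcases h with ⟨x, y, b, h, rfl⟩ | ⟨q, i, v, S, h, rfl⟩
  · have hv : Valid (st (st T x (.leaf b)) y (.leaf b)) := by
      obtain ⟨hne, σ, l, hσ, rfl, hl⟩ := id h
      exact (RedA.emb hQ.valid.lin hne hσ hl).valid hQ.valid
    obtain ⟨Q1, hQ1⟩ := hv.exists_lab
    exact ⟨Q1, hQ1, Or.inl (stepA_of_red h hQ hQ1)⟩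
  · obtain ⟨Q1, hQ1⟩ := (h.emb.valid hQ.valid).exists_lab
    exact ⟨Q1, hQ1, Or.inr ⟨_, _, _, _, stepB_of_red h hQ hQ1⟩⟩

theorem Lab.scale {T : Bool → LT α} {Q : Couple} (h : Lab T Q) : Q.scale = tsize T := by
  have h1 := h.1 true
  have h2 := h.1 false
  simp only [Couple.treeOf, cond_true, cond_false] at h1 h2
  rw [Couple.scale, tsize, ← h1, ← h2, LT.size_eq, LT.size_eq]

end compare

/-! ### The skeleton -/

theorem Step.scale_lt {Q1 Q : Couple} (h : Step Q1 Q) : Q1.scale < Q.scale := by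
  obtain ⟨T, hT⟩ := exists_labelling Q
  obtain ⟨T1, hr, hT1⟩ := red_of_step s(((true, []) : NodeId), (true, [])) hT h
  rw [hT.scale, hT1.scale]
  exact hr.tsize_lt

theorem step_diamond {Q Q1 Q2 : Couple} (h1 : Step Q1 Q) (h2 : Step Q2 Q) :
    Q1 = Q2 ∨ ∃ Q0, Step Q0 Q1 ∧ Step Q0 Q2 := by
  obtain ⟨T, hT⟩ := exists_labelling Q
  obtain ⟨T1, hr1, hT1⟩ := red_of_step s(((true, []) : NodeId), (true, [])) hT h1
  obtain ⟨T2, hr2, hT2⟩ := red_of_step s(((true, []) : NodeId), (true, [])) hT h2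
  rcases diamond_red hT.valid.lin hr1 hr2 with rfl | ⟨T0, g1, g2⟩
  · exact Or.inl (hT1.unique hT2)
  · obtain ⟨Q0, hQ0, s1⟩ := step_of_red hT1 g1
    obtain ⟨Q0', hQ0', s2⟩ := step_of_red hT2 g2
    obtain rfl := hQ0.unique hQ0'
    exact Or.inr ⟨Q0, s1, s2⟩

theorem exists_skeleton (Q : Couple) : ∃ Qsk, HasSkeleton Q Qsk := by
  induction hn : Q.scale using Nat.strong_induction_on generalizing Q with
  | _ n ih =>
    by_cases hp : IsPrime Q
    · exact ⟨Q, hp, Relation.ReflTransGen.refl⟩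
    · obtain ⟨Q', -, hs⟩ := not_not.1 hp
      obtain ⟨Qsk, h1, h2⟩ := ih Q'.scale (hn ▸ hs.scale_lt) Q' rfl
      exact ⟨Qsk, h1, h2.tail hs⟩

theorem prime_reach {P D : Couple} (hP : IsPrime P)
    (h : Relation.ReflTransGen (Function.swap Step) P D) : P = D := by
  rcases Relation.ReflTransGen.cases_head h with rfl | ⟨c, hc, -⟩
  · rfl
  · refine absurd ⟨c, ?_, hc⟩ hP
    rintro rfl
    exact lt_irrefl _ (Step.scale_lt hc)

theorem skeleton_unique {Q P P' : Couple} (h : HasSkeleton Q P) (h' : HasSkeleton Q P') :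
    P = P' := by
  have cr := Relation.church_rosser (r := Function.swap Step) (a := Q) (b := P) (c := P')
    (by
      intro a b c hb hc
      rcases step_diamond hb hc with rfl | ⟨d, h1, h2⟩
      · exact ⟨b, .refl, .refl⟩
      · exact ⟨d, .single h1, .single h2⟩)
    (Relation.reflTransGen_swap.2 h.2) (Relation.reflTransGen_swap.2 h'.2)
  obtain ⟨D, h1, h2⟩ := cr
  rw [prime_reach h.1 h1, prime_reach h'.1 h2]

theorem trivial_prime : IsPrime trivialCouple := by
  rintro ⟨Q', -, h⟩
  have := Step.scale_lt h
  simp [Couple.scale, trivialCouple, TTree.scale] at this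

/-- Proposition 3.11 of Deng–Hani: every couple has a unique skeleton, and a couple is
regular if and only if its skeleton is the trivial couple. -/
theorem skeleton_exists_unique (Q : Couple) :
    (∃! Qsk : Couple, HasSkeleton Q Qsk) ∧
      (∀ Qsk : Couple, HasSkeleton Q Qsk → (Regular Q ↔ Qsk = trivialCouple)) := by
  obtain ⟨P, hP⟩ := exists_skeleton Q
  refine ⟨⟨P, hP, fun P' hP' => skeleton_unique hP' hP⟩, fun P' hP' => ⟨fun hr => ?_, ?_⟩⟩
  · exact skeleton_unique hP' ⟨trivial_prime, hr⟩
  · rintro rfl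
    exact hP'.2

end WKE
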